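/- arXiv:2206.04642 — 4 statements merged into one kernel-verified Lean document; each statement's English description precedes it below -/
import Mathlib

section
/- Let ρ_t be an everywhere-positive probability density on ℝ^d, C¹ in t and C² in x, solving the transport equation ∂_t ρ_t(x) = −∇·(v_t(x) ρ_t(x)) with a velocity field v_t that is C² in t and x. Let X_t(x) solve the probability flow equation dX_t(x)/dt = v_t(X_t(x)) with X_0(x) = x. Then for every x ∈ ℝ^d the curve G_t(x) := ∇log ρ_t(X_t(x)) satisfies the ordinary differential equation dG_t(x)/dt = −[∇v_t(X_t(x))]ᵀ G_t(x) − ∇(∇·v_t)(X_t(x)), with initial condition G_0(x) = ∇log ρ_0(x). -/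
open MeasureTheory Matrix Filter
open scoped Topology

noncomputable section

/-- The gradient of a scalar field on `Fin d → ℝ`. -/
def grad {d : ℕ} (f : (Fin d → ℝ) → ℝ) (x : Fin d → ℝ) : Fin d → ℝ :=
  fun i => fderiv ℝ f x (Pi.single i 1)

/-- The divergence of a vector field on `Fin d → ℝ`. -/
def dvg {d : ℕ} (F : (Fin d → ℝ) → (Fin d → ℝ)) (x : Fin d → ℝ) : ℝ :=
  ∑ i, fderiv ℝ F x (Pi.single i 1) i

/-- The Jacobian matrix `∇v` of a vector field, `(∇v)_{ij} = ∂_j v_i`. -/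
def jac {d : ℕ} (F : (Fin d → ℝ) → (Fin d → ℝ)) (x : Fin d → ℝ) :
    Matrix (Fin d) (Fin d) ℝ :=
  Matrix.of fun i j => fderiv ℝ F x (Pi.single j 1) i

section

section Flow

variable {E : Type*} [NormedAddCommGroup E] [NormedSpace ℝ E]
  {v : ℝ → E → E} {X : ℝ → E → E} {K : NNReal}

theorem norm_flow_sub_flow_le_of_le (hlip : ∀ t, LipschitzWith K (v t))
    (hX : ∀ t x, HasDerivAt (fun τ => X τ x) (v t (X t x)) t) {s t : ℝ} (hst : s ≤ t) (x y : E) :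
    ‖X t x - X t y‖ ≤ ‖X s x - X s y‖ * Real.exp (K * (t - s)) := by
  have h := dist_le_of_trajectories_ODE (v := v) (K := K) (a := s) (b := t)
    (f := fun τ => X τ x) (g := fun τ => X τ y) (δ := ‖X s x - X s y‖) hlip
    (fun τ _ => (hX τ x).continuousAt.continuousWithinAt)
    (fun τ _ => (hX τ x).hasDerivWithinAt)
    (fun τ _ => (hX τ y).continuousAt.continuousWithinAt)
    (fun τ _ => (hX τ y).hasDerivWithinAt) (dist_eq_norm _ _).le t ⟨hst, le_rfl⟩
  rwa [dist_eq_norm] at h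

theorem norm_flow_sub_flow_le (hlip : ∀ t, LipschitzWith K (v t))
    (hX : ∀ t x, HasDerivAt (fun τ => X τ x) (v t (X t x)) t) (s t : ℝ) (x y : E) :
    ‖X t x - X t y‖ ≤ ‖X s x - X s y‖ * Real.exp (K * |t - s|) := by
  rcases le_total s t with hst | hts
  · rw [abs_of_nonneg (sub_nonneg.2 hst)]
    exact norm_flow_sub_flow_le_of_le hlip hX hst x y
  · have h := norm_flow_sub_flow_le_of_le (K := K) (v := fun t x => -v (-t) x)
      (X := fun t x => X (-t) x) (fun t => (hlip (-t)).neg)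
      (fun t x => by
        simpa [Function.comp_def] using (hX (-t) x).scomp t (hasDerivAt_neg t)) (neg_le_neg hts) x y
    rw [abs_of_nonpos (sub_nonpos.2 hts)]
    simp only [neg_neg] at h
    convert h using 4
    ring

theorem continuous_uncurry_flow (hlip : ∀ t, LipschitzWith K (v t))
    (hX : ∀ t x, HasDerivAt (fun τ => X τ x) (v t (X t x)) t) (hX0 : ∀ x, X 0 x = x) :
    Continuous (Function.uncurry X) := by
  rw [continuous_iff_continuousAt]
  rintro ⟨t, x⟩
  rw [ContinuousAt, tendsto_iff_norm_sub_tendsto_zero]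
  have hc : ContinuousAt (fun p : ℝ × E => X p.1 x) (t, x) :=
    ContinuousAt.comp' (g := fun τ => X τ x) (f := Prod.fst) (hX t x).continuousAt continuousAt_fst
  have hlim : Tendsto (fun p : ℝ × E => ‖p.2 - x‖ * Real.exp (K * |p.1|) + ‖X p.1 x - X t x‖)
      (𝓝 (t, x)) (𝓝 0) := by
    have h1 : Tendsto (fun p : ℝ × E => ‖p.2 - x‖ * Real.exp (K * |p.1|)) (𝓝 (t, x))
        (𝓝 (‖x - x‖ * Real.exp (K * |t|))) :=
      (show Continuous fun p : ℝ × E => ‖p.2 - x‖ * Real.exp (K * |p.1|) by fun_prop).tendsto (t, x)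
    have h2 := tendsto_iff_norm_sub_tendsto_zero.1 hc
    simpa using h1.add h2
  refine squeeze_zero (fun _ => norm_nonneg _) (fun p => ?_) hlim
  have h := norm_flow_sub_flow_le hlip hX 0 p.1 p.2 x
  simp only [hX0, sub_zero] at h
  calc ‖X p.1 p.2 - X t x‖ = ‖(X p.1 p.2 - X p.1 x) + (X p.1 x - X t x)‖ := by abel_nf
    _ ≤ _ := (norm_add_le _ _).trans (by gcongr)

theorem flow_surjective [CompleteSpace E] (hlip : ∀ t, LipschitzWith K (v t))
    (hX : ∀ t x, HasDerivAt (fun τ => X τ x) (v t (X t x)) t) (hX0 : ∀ x, X 0 x = x) (t : ℝ) :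
    Function.Surjective (X t) := by
  obtain ⟨h, hpos, hh⟩ : ∃ h : ℝ, 0 < h ∧ K * Real.exp (K * h) * h ≤ 1 / 2 := by
    have hc : Tendsto (fun h : ℝ => K * Real.exp (K * h) * h) (𝓝[>] 0) (𝓝 0) := by
      have : Continuous fun h : ℝ => (K : ℝ) * Real.exp (K * h) * h := by fun_prop
      simpa using (this.tendsto 0).mono_left nhdsWithin_le_nhds
    obtain ⟨h, h1, h2⟩ := ((hc.eventually (ge_mem_nhds (by norm_num : (0 : ℝ) < 1 / 2))).and
      self_mem_nhdsWithin).exists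
    exact ⟨h, h2, h1⟩
  have step : ∀ s t : ℝ, |t - s| ≤ h → Function.Surjective (X s) → Function.Surjective (X t) := by
    intro s t hst hs y
    obtain ⟨Y, hY⟩ := hs.hasRightInverse
    have hdiff : ∀ x x' : E, ‖(X t x - X t x') - (X s x - X s x')‖ ≤ 1 / 2 * ‖X s x - X s x'‖ := by
      intro x x'
      have := Convex.norm_image_sub_le_of_norm_hasDerivWithin_le
        (f := fun τ => X τ x - X τ x') (f' := fun τ => v τ (X τ x) - v τ (X τ x'))
        (s := Set.uIcc s t) (C := K * (‖X s x - X s x'‖ * Real.exp (K * h)))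
        (fun τ _ => ((hX τ x).sub (hX τ x')).hasDerivWithinAt)
        (fun τ hτ => by
          have h1 := (hlip τ).norm_sub_le (X τ x) (X τ x')
          have h2 := norm_flow_sub_flow_le hlip hX s τ x x'
          have h3 : |τ - s| ≤ h := (Set.abs_sub_left_of_mem_uIcc hτ).trans hst
          refine h1.trans (mul_le_mul_of_nonneg_left (h2.trans ?_) K.2)
          gcongr)
        (convex_uIcc s t) Set.left_mem_uIcc Set.right_mem_uIcc
      refine this.trans ?_
      rw [Real.norm_eq_abs]
      calc K * (‖X s x - X s x'‖ * Real.exp (K * h)) * |t - s|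
          ≤ K * (‖X s x - X s x'‖ * Real.exp (K * h)) * h := by gcongr
        _ = (K * Real.exp (K * h) * h) * ‖X s x - X s x'‖ := by ring
        _ ≤ _ := by gcongr
    have hcontr : ContractingWith (1 / 2) (fun z => y - (X t (Y z) - z)) := by
      refine ⟨by rw [← NNReal.coe_lt_coe]; norm_num, LipschitzWith.of_dist_le_mul fun z w => ?_⟩
      have := hdiff (Y w) (Y z)
      rw [hY, hY, norm_sub_rev w z] at this
      rw [dist_eq_norm, dist_eq_norm]
      refine le_trans (le_of_eq ?_) (this.trans (by simp))
      congr 1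
      abel
    have hfix := hcontr.fixedPoint_isFixedPt
    refine ⟨Y (hcontr.fixedPoint), ?_⟩
    have : y - (X t (Y hcontr.fixedPoint) - hcontr.fixedPoint) = hcontr.fixedPoint := hfix
    rw [sub_eq_iff_eq_add] at this
    simpa using this.symm
  have hclopen : IsClopen {s | Function.Surjective (X s)} := by
    constructor
    · rw [← isOpen_compl_iff, Metric.isOpen_iff]
      refine fun s hs => ⟨h, hpos, fun t ht hsurj => hs (step t s ?_ hsurj)⟩
      rw [abs_sub_comm]
      exact (Metric.mem_ball.1 ht).le
    · rw [Metric.isOpen_iff]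
      exact fun s hs => ⟨h, hpos, fun t ht => step s t (Metric.mem_ball.1 ht).le hs⟩
  have := hclopen.eq_univ ⟨0, fun y => ⟨y, hX0 y⟩⟩
  exact Set.eq_univ_iff_forall.1 this t

end Flow

section SegmentBound

variable {E : Type*} [NormedAddCommGroup E] [NormedSpace ℝ E]

/-- A quantitative `C^{1,1}` bound with constant `n` on the set `B`, expressed through the values
of `h` only so that it is stable under pointwise limits. -/
def SegmentBound (n : ℝ) (B : Set E) (h : E → ℝ) : Prop :=
  ∀ x ∈ B, ∀ y ∈ B, |h y - h x| ≤ n * ‖y - x‖ ∧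
    ∀ c ∈ Set.Ioc (0 : ℝ) 1,
      |c * (h y - h x) - (h (x + c • (y - x)) - h x)| ≤ c * (n * ‖y - x‖ ^ 2)

theorem exists_nat_segmentBound [FiniteDimensional ℝ E] {h : E → ℝ} (hh : ContDiff ℝ 2 h) (R : ℝ) :
    ∃ n : ℕ, SegmentBound n (Metric.ball (0 : E) R) h := by
  have : ProperSpace E := FiniteDimensional.proper_real E
  have hd : Differentiable ℝ h := hh.differentiable (by norm_num)
  have hh1 : ContDiff ℝ 1 (fderiv ℝ h) := hh.fderiv_right (by norm_num)
  have hd1 : Differentiable ℝ (fderiv ℝ h) := hh1.differentiable (by norm_num)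
  obtain ⟨A, hA⟩ := (isCompact_closedBall (0 : E) R).exists_bound_of_continuousOn
    hh1.continuous.continuousOn
  obtain ⟨A', hA'⟩ := (isCompact_closedBall (0 : E) R).exists_bound_of_continuousOn
    (hh1.continuous_fderiv (by norm_num)).continuousOn
  have hball : Metric.ball (0 : E) R ⊆ Metric.closedBall 0 R := Metric.ball_subset_closedBall
  have hconv := convex_ball (0 : E) R
  have hlip : ∀ x ∈ Metric.ball (0 : E) R, ∀ y ∈ Metric.ball (0 : E) R,
      ‖h y - h x‖ ≤ A * ‖y - x‖ := fun x hx y hy =>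
    hconv.norm_image_sub_le_of_norm_fderiv_le (fun z _ => hd z) (fun z hz => hA z (hball hz)) hx hy
  have htaylor : ∀ x ∈ Metric.ball (0 : E) R, ∀ y ∈ Metric.ball (0 : E) R,
      ‖h y - h x - fderiv ℝ h x (y - x)‖ ≤ A' * ‖y - x‖ * ‖y - x‖ := by
    intro x hx y hy
    have hA'0 : 0 ≤ A' := (norm_nonneg _).trans (hA' x (hball hx))
    refine (convex_segment x y).norm_image_sub_le_of_norm_hasFDerivWithin_le'
      (f' := fderiv ℝ h) (fun z _ => (hd z).hasFDerivAt.hasFDerivWithinAt) (fun z hz => ?_)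
      (left_mem_segment ℝ x y) (right_mem_segment ℝ x y)
    have hzB := hconv.segment_subset hx hy hz
    refine (hconv.norm_image_sub_le_of_norm_fderiv_le (fun z _ => hd1 z)
      (fun z hz => hA' z (hball hz)) hx hzB).trans ?_
    gcongr
    exact norm_sub_le_of_mem_segment hz
  obtain ⟨n, hn⟩ := exists_nat_ge (max A (2 * A'))
  refine ⟨n, fun x hx y hy => ⟨(hlip x hx y hy).trans ?_, fun c hc => ?_⟩⟩
  · gcongr
    exact (le_max_left _ _).trans hn
  · have hA'0 : 0 ≤ A' := (norm_nonneg _).trans (hA' x (hball hx))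
    have hz : x + c • (y - x) ∈ Metric.ball (0 : E) R :=
      hconv.add_smul_sub_mem hx hy ⟨hc.1.le, hc.2⟩
    have h1 := htaylor x hx y hy
    have h2 := htaylor x hx _ hz
    rw [add_sub_cancel_left, norm_smul, Real.norm_of_nonneg hc.1.le, map_smul, smul_eq_mul] at h2
    rw [Real.norm_eq_abs] at h1 h2
    have h3 : (2 * A') * ‖y - x‖ ^ 2 ≤ n * ‖y - x‖ ^ 2 := by
      gcongr
      exact (le_max_right _ _).trans hn
    have h4 : A' * (c * ‖y - x‖) * (c * ‖y - x‖) ≤ c * (A' * ‖y - x‖ ^ 2) := by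
      have : A' * (c * ‖y - x‖) * (c * ‖y - x‖) = c * (c * (A' * ‖y - x‖ ^ 2)) := by ring
      rw [this]
      exact mul_le_mul_of_nonneg_left (mul_le_of_le_one_left (by positivity) hc.2) hc.1.le
    calc |c * (h y - h x) - (h (x + c • (y - x)) - h x)|
        = |c * (h y - h x - fderiv ℝ h x (y - x))
            - (h (x + c • (y - x)) - h x - c * fderiv ℝ h x (y - x))| := by ring_nf
      _ ≤ c * |h y - h x - fderiv ℝ h x (y - x)|
            + |h (x + c • (y - x)) - h x - c * fderiv ℝ h x (y - x)| := by
          refine (abs_sub _ _).trans ?_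
          rw [abs_mul, abs_of_pos hc.1]
      _ ≤ c * (A' * ‖y - x‖ * ‖y - x‖) + c * (A' * ‖y - x‖ ^ 2) := by
          have := mul_le_mul_of_nonneg_left h1 hc.1.le
          linarith
      _ = c * ((2 * A') * ‖y - x‖ ^ 2) := by ring
      _ ≤ _ := mul_le_mul_of_nonneg_left h3 hc.1.le

theorem isClosed_setOf_segmentBound {f : ℝ → E → ℝ} (hf : ∀ x, Continuous fun t => f t x)
    (n : ℝ) (B : Set E) : IsClosed {t | SegmentBound n B (f t)} := by
  simp only [SegmentBound, Set.ofPred_forall, Set.ofPred_and]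
  refine isClosed_biInter fun x _ => isClosed_biInter fun y _ => IsClosed.inter ?_ <|
    isClosed_biInter fun c _ => ?_
  · exact isClosed_le ((hf y).sub (hf x)).abs continuous_const
  · exact isClosed_le (((hf y).sub (hf x)).const_mul c |>.sub ((hf _).sub (hf x))).abs
      continuous_const

theorem SegmentBound.abs_sub_fderiv_le {n : ℝ} {B : Set E} {h : E → ℝ} (hh : SegmentBound n B h)
    {x y : E} (hd : DifferentiableAt ℝ h x) (hx : x ∈ B) (hy : y ∈ B) :
    |h y - h x - fderiv ℝ h x (y - x)| ≤ n * ‖y - x‖ ^ 2 := by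
  have hline : HasDerivAt (fun c : ℝ => h (x + c • (y - x))) (fderiv ℝ h x (y - x)) 0 := by
    have h1 : HasDerivAt (fun c : ℝ => x + c • (y - x)) (y - x) 0 := by
      simpa using ((hasDerivAt_id (0 : ℝ)).smul_const (y - x)).const_add x
    exact HasFDerivAt.comp_hasDerivAt (0 : ℝ) (f := fun c : ℝ => x + c • (y - x)) (l := h)
      (by simpa using hd.hasFDerivAt) h1
  have hslope := hline.tendsto_slope_zero_right
  simp only [zero_add, zero_smul, add_zero, smul_eq_mul] at hslope
  refine le_of_tendsto (hslope.const_sub (h y - h x)).abs ?_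
  filter_upwards [Ioc_mem_nhdsGT (zero_lt_one (α := ℝ))] with c hc
  have := (hh x hx y hy).2 c hc
  rw [← mul_le_mul_iff_right₀ hc.1]
  refine le_trans (le_of_eq ?_) this
  rw [← abs_of_pos hc.1, ← abs_mul, abs_of_pos hc.1, mul_sub, mul_inv_cancel_left₀ hc.1.ne']

theorem tendsto_fderiv_apply_of_segmentBound {f : ℝ → E → ℝ} {F : Set ℝ} {t n : ℝ} {B : Set E}
    (hB : IsOpen B) (ht : t ∈ F) (hbd : ∀ᶠ s in 𝓝[F] t, SegmentBound n B (f s))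
    (hd : ∀ s, Differentiable ℝ (f s)) (hc : ∀ x, Continuous fun s => f s x)
    {p : E} (hp : p ∈ B) (w : E) :
    Tendsto (fun s => fderiv ℝ (f s) p w) (𝓝[F] t) (𝓝 (fderiv ℝ (f t) p w)) := by
  rw [Metric.tendsto_nhds]
  intro ε hε
  obtain ⟨δ, hδ, hδB, hδε⟩ : ∃ δ : ℝ, 0 < δ ∧ p + δ • w ∈ B ∧ 2 * n * δ * ‖w‖ ^ 2 < ε / 2 := by
    have h1 : ∀ᶠ δ in 𝓝[>] (0 : ℝ), p + δ • w ∈ B := by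
      have : Continuous fun δ : ℝ => p + δ • w := by fun_prop
      exact ((this.tendsto 0).mono_left nhdsWithin_le_nhds).eventually
        (hB.mem_nhds (by simpa using hp))
    have h2 : ∀ᶠ δ in 𝓝[>] (0 : ℝ), 2 * n * δ * ‖w‖ ^ 2 < ε / 2 := by
      have : Continuous fun δ : ℝ => 2 * n * δ * ‖w‖ ^ 2 := by fun_prop
      exact ((this.tendsto 0).mono_left nhdsWithin_le_nhds).eventually
        (gt_mem_nhds (by simpa using half_pos hε))
    obtain ⟨δ, h, h'⟩ := ((h1.and h2).and self_mem_nhdsWithin).exists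
    exact ⟨δ, h', h⟩
  have hclose : ∀ x, ∀ᶠ s in 𝓝[F] t, |f s x - f t x| < ε * δ / 4 := fun x => by
    have := Metric.tendsto_nhds.1 (((hc x).tendsto t).mono_left
      (nhdsWithin_le_nhds (s := F))) (ε * δ / 4) (by positivity)
    simpa [Real.dist_eq] using this
  have htb := hbd.self_of_nhdsWithin ht
  filter_upwards [hbd, hclose p, hclose (p + δ • w)] with s hs h1 h2
  have h3 := hs.abs_sub_fderiv_le (hd s p) hp hδB
  have h4 := htb.abs_sub_fderiv_le (hd t p) hp hδB
  rw [add_sub_cancel_left, map_smul, smul_eq_mul, norm_smul, Real.norm_of_nonneg hδ.le] at h3 h4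
  rw [Real.dist_eq, ← mul_lt_mul_iff_right₀ hδ, ← abs_of_pos hδ, ← abs_mul, abs_of_pos hδ]
  have h5 := mul_lt_mul_of_pos_left hδε hδ
  rw [abs_le] at h3 h4
  rw [abs_lt] at h1 h2 ⊢
  constructor <;> nlinarith

theorem hasDerivWithinAt_comp_of_segmentBound {f : ℝ → E → ℝ} {F : Set ℝ} {t n a : ℝ} {B : Set E}
    (hB : IsOpen B) (ht : t ∈ F) (hbd : ∀ᶠ s in 𝓝[F] t, SegmentBound n B (f s))
    (hd : ∀ s, Differentiable ℝ (f s)) (hc : ∀ x, Continuous fun s => f s x)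
    {γ : ℝ → E} {w : E} (hγ : HasDerivAt γ w t) (hp : γ t ∈ B)
    (ha : HasDerivAt (fun s => f s (γ t)) a t) :
    HasDerivWithinAt (fun s => f s (γ s)) (a + fderiv ℝ (f t) (γ t) w) F t := by
  have hlim := tendsto_fderiv_apply_of_segmentBound hB ht hbd hd hc hp w
  have hlin : HasDerivAt (fun s => γ t + (s - t) • w) w t := by
    simpa using (((hasDerivAt_id t).sub_const t).smul_const w).const_add (γ t)
  have hlinB : ∀ᶠ s in 𝓝[F] t, γ t + (s - t) • w ∈ B :=
    (hlin.continuousAt.mono_left nhdsWithin_le_nhds).eventually (hB.mem_nhds (by simpa using hp))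
  have hγB : ∀ᶠ s in 𝓝[F] t, γ s ∈ B :=
    (hγ.continuousAt.mono_left nhdsWithin_le_nhds).eventually (hB.mem_nhds hp)
  have h1 : (fun s => f s (γ s) - f s (γ t + (s - t) • w)) =o[𝓝[F] t] fun s => s - t := by
    refine Asymptotics.IsBigO.trans_isLittleO ?_
      ((hasDerivAt_iff_isLittleO.1 hγ).mono nhdsWithin_le_nhds)
    refine Asymptotics.IsBigO.of_bound n ?_
    filter_upwards [hbd, hlinB, hγB] with s hs hl hg
    simpa [sub_sub] using (hs _ hl _ hg).1
  have h2 : (fun s => f s (γ t + (s - t) • w) - f s (γ t) - (s - t) * fderiv ℝ (f s) (γ t) w)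
      =o[𝓝[F] t] fun s => s - t := by
    have hO : (fun s => f s (γ t + (s - t) • w) - f s (γ t) - (s - t) * fderiv ℝ (f s) (γ t) w)
        =O[𝓝[F] t] fun s => (s - t) * (s - t) := by
      refine Asymptotics.IsBigO.of_bound (n * ‖w‖ ^ 2) ?_
      filter_upwards [hbd, hlinB] with s hs hl
      have := hs.abs_sub_fderiv_le (hd s _) hp hl
      rw [add_sub_cancel_left, map_smul, smul_eq_mul, norm_smul] at this
      rw [norm_mul, Real.norm_eq_abs (_ - _ - _)]
      linarith
    refine hO.trans_isLittleO ?_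
    have hto : (fun s => s - t) =o[𝓝[F] t] fun _ => (1 : ℝ) := by
      rw [Asymptotics.isLittleO_one_iff]
      have : Continuous fun s : ℝ => s - t := by fun_prop
      simpa using (this.tendsto t).mono_left (nhdsWithin_le_nhds (s := F))
    simpa using hto.mul_isBigO (Asymptotics.isBigO_refl (fun s => s - t) (𝓝[F] t))
  have h3 : (fun s => (s - t) * (fderiv ℝ (f s) (γ t) w - fderiv ℝ (f t) (γ t) w))
      =o[𝓝[F] t] fun s => s - t := by
    have hto : (fun s => fderiv ℝ (f s) (γ t) w - fderiv ℝ (f t) (γ t) w)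
        =o[𝓝[F] t] fun _ => (1 : ℝ) := by
      rw [Asymptotics.isLittleO_one_iff]
      simpa using hlim.sub_const (fderiv ℝ (f t) (γ t) w)
    simpa using (Asymptotics.isBigO_refl (fun s => s - t) (𝓝[F] t)).mul_isLittleO hto
  have h4 := (hasDerivAt_iff_isLittleO.1 ha).mono (nhdsWithin_le_nhds (s := F))
  rw [hasDerivWithinAt_iff_isLittleO]
  refine (((h1.add h2).add h3).add h4).congr_left fun s => ?_
  simp only [smul_eq_mul]
  ring

end SegmentBound

section Transport

variable {E : Type*} [NormedAddCommGroup E] [NormedSpace ℝ E]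
  {v : ℝ → E → E} {X : ℝ → E → E} {K : NNReal} {f q : ℝ → E → ℝ}

/-- The quantity conserved along the flow `X` when `f` solves `∂ₜf + v·∇f = -q`. -/
def flowInvariant (f q : ℝ → E → ℝ) (X : ℝ → E → E) (x : E) (t : ℝ) : ℝ :=
  f t (X t x) + ∫ s in (0 : ℝ)..t, q s (X s x)

theorem hasDerivAt_integral_flow (hX : ∀ t x, HasDerivAt (fun τ => X τ x) (v t (X t x)) t)
    (hq : Continuous (Function.uncurry q)) (x : E) (t : ℝ) :
    HasDerivAt (fun t => ∫ s in (0 : ℝ)..t, q s (X s x)) (q t (X t x)) t := by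
  have hXc : Continuous fun s => X s x :=
    continuous_iff_continuousAt.2 fun s => (hX s x).continuousAt
  have hc : Continuous fun s => q s (X s x) := hq.comp₂ continuous_id hXc
  exact intervalIntegral.integral_hasDerivAt_right (hc.intervalIntegrable _ _)
    (hc.stronglyMeasurableAtFilter _ _) hc.continuousAt

theorem flowInvariant_eq_of_mem_closure [CompleteSpace E] (hlip : ∀ t, LipschitzWith K (v t))
    (hX : ∀ t x, HasDerivAt (fun τ => X τ x) (v t (X t x)) t) (hX0 : ∀ x, X 0 x = x)
    (hfx : ∀ t, Continuous (f t)) (hft : ∀ x, Continuous fun t => f t x)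
    (hq : Continuous (Function.uncurry q)) {S : Set ℝ} {U : Set E} (hU : IsOpen U) {c m : ℝ}
    (hS : ∀ τ ∈ S, ∀ x ∈ U, flowInvariant f q X x τ = flowInvariant f q X x m)
    (hc : c ∈ closure S) {x : E} (hx : x ∈ U) :
    flowInvariant f q X x c = flowInvariant f q X x m := by
  have hXc := continuous_uncurry_flow hlip hX hX0
  have hQ : Continuous fun p : E × ℝ => ∫ s in (0 : ℝ)..p.2, q s (X s p.1) := by
    refine intervalIntegral.continuous_parametric_intervalIntegral_of_continuous
      (f := fun (p : E × ℝ) s => q s (X s p.1)) ?_ continuous_snd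
    exact hq.comp₂ continuous_snd (hXc.comp₂ continuous_snd (continuous_fst.comp continuous_fst))
  choose Y hY using fun τ => flow_surjective hlip hX hX0 τ (X c x)
  have hYx : Tendsto Y (𝓝 c) (𝓝 x) := by
    rw [tendsto_iff_norm_sub_tendsto_zero]
    have hlim : Tendsto (fun τ => ‖X c x - X τ x‖ * Real.exp (K * |0 - τ|)) (𝓝 c) (𝓝 0) := by
      have : Continuous fun τ => ‖X c x - X τ x‖ * Real.exp (K * |0 - τ|) := by
        have : Continuous fun τ => X τ x :=
          continuous_iff_continuousAt.2 fun s => (hX s x).continuousAt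
        fun_prop
      simpa using this.tendsto c
    refine squeeze_zero (fun _ => norm_nonneg _) (fun τ => ?_) hlim
    have := norm_flow_sub_flow_le hlip hX τ 0 (Y τ) x
    rwa [hX0, hX0, hY] at this
  have hne : (𝓝[S] c).NeBot := mem_closure_iff_nhdsWithin_neBot.1 hc
  have hYx' : Tendsto Y (𝓝[S] c) (𝓝 x) := hYx.mono_left nhdsWithin_le_nhds
  have hid : Tendsto (fun τ : ℝ => τ) (𝓝[S] c) (𝓝 c) := tendsto_id.mono_left nhdsWithin_le_nhds
  have h1 : Tendsto (fun τ => flowInvariant f q X (Y τ) m) (𝓝[S] c)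
      (𝓝 (flowInvariant f q X x m)) := by
    have : Continuous fun y => flowInvariant f q X y m :=
      ((hfx m).comp (hXc.comp₂ continuous_const continuous_id)).add
        (hQ.comp₂ continuous_id continuous_const)
    exact (this.tendsto x).comp hYx'
  have h2 : Tendsto (fun τ => flowInvariant f q X (Y τ) τ) (𝓝[S] c)
      (𝓝 (flowInvariant f q X x c)) := by
    simp only [flowInvariant, hY]
    exact (((hft (X c x)).tendsto c).comp hid).add
      ((hQ.tendsto (x, c)).comp (hYx'.prodMk_nhds hid))
  refine tendsto_nhds_unique (h2.congr' ?_) h1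
  filter_upwards [self_mem_nhdsWithin, hYx'.eventually (hU.mem_nhds hx)] with τ hτ hYτ
  exact hS τ hτ _ hYτ

theorem hasDerivAt_zero_of_gaps {ι : Type*} {g : ι → ℝ → ℝ} {F : Set ℝ} (hF : IsClosed F)
    {a b : ℝ} (hext : ∀ (S : Set ℝ) (c m : ℝ), (∀ τ ∈ S, ∀ i, g i τ = g i m) → c ∈ closure S →
      ∀ i, g i c = g i m)
    (hgap : ∀ t ∉ F, ∀ i, HasDerivAt (g i) 0 t)
    (hFd : ∀ t ∈ F ∩ Set.Ioo a b, ∀ i, HasDerivWithinAt (g i) 0 F t) :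
    ∀ t ∈ Set.Ioo a b, ∀ i, HasDerivAt (g i) 0 t := by
  intro t htab i
  by_cases htF : t ∉ F
  · exact hgap t htF i
  rw [not_not] at htF
  have hnear : ∀ s, ∃ c ∈ F ∩ Set.uIcc t s, ∀ j, g j c = g j s := by
    intro s
    have hcomp : IsCompact (F ∩ Set.uIcc t s) := isCompact_uIcc.inter_left hF
    obtain ⟨c, hc, hdist⟩ := hcomp.exists_infDist_eq_dist ⟨t, htF, Set.left_mem_uIcc⟩ s
    refine ⟨c, hc, fun j => ?_⟩
    by_cases hcs : c = s
    · rw [hcs]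
    have hdisj : ∀ p ∈ openSegment ℝ c s, p ∉ F := by
      intro p hp hpF
      have hpI : p ∈ Set.uIcc t s :=
        (convex_uIcc t s).openSegment_subset hc.2 Set.right_mem_uIcc hp
      have h1 := Metric.infDist_le_dist_of_mem (x := s) (show p ∈ F ∩ Set.uIcc t s from ⟨hpF, hpI⟩)
      rw [hdist] at h1
      obtain ⟨u, w, hu, hw, huw, rfl⟩ := hp
      have h2 : s - (u • c + w • s) = u * (s - c) := by
        simp only [smul_eq_mul]
        linear_combination (-s) * huw
      rw [Real.dist_eq, Real.dist_eq, h2, abs_mul, abs_of_pos hu] at h1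
      have h3 : 0 < |s - c| := abs_pos.2 (sub_ne_zero.2 (Ne.symm hcs))
      nlinarith
    have hm : midpoint ℝ c s ∈ openSegment ℝ c s := midpoint_mem_openSegment c s
    have hconst : ∀ τ ∈ openSegment ℝ c s, ∀ k, g k τ = g k (midpoint ℝ c s) := by
      intro τ hτ k
      have := (convex_openSegment c s).norm_image_sub_le_of_norm_hasDerivWithin_le (f := g k)
        (f' := fun _ => 0) (C := 0) (fun x hx => (hgap x (hdisj x hx) k).hasDerivWithinAt)
        (by simp) hm hτ
      simpa [sub_eq_zero] using this
    rw [hext _ c _ hconst (by rw [closure_openSegment]; exact left_mem_segment ℝ c s) j,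
      hext _ s _ hconst (by rw [closure_openSegment]; exact right_mem_segment ℝ c s) j]
  have hw := hFd t ⟨htF, htab⟩ i
  rw [hasDerivWithinAt_iff_isLittleO] at hw
  rw [hasDerivAt_iff_isLittleO, Asymptotics.isLittleO_iff]
  intro ε hε
  have hev := (Asymptotics.isLittleO_iff.1 hw) hε
  rw [eventually_nhdsWithin_iff, Metric.eventually_nhds_iff] at hev
  obtain ⟨η, hη, hev⟩ := hev
  rw [Metric.eventually_nhds_iff]
  refine ⟨η, hη, fun s hs => ?_⟩
  obtain ⟨c, ⟨hcF, hcI⟩, hcs⟩ := hnear s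
  have hle : |c - t| ≤ |s - t| := Set.abs_sub_left_of_mem_uIcc hcI
  have := hev (y := c) (lt_of_le_of_lt (by simpa [Real.dist_eq] using hle) hs) hcF
  rw [← hcs i]
  simp only [smul_zero, sub_zero, Real.norm_eq_abs] at this ⊢
  exact this.trans (by gcongr)

theorem hasDerivAt_comp_flow [FiniteDimensional ℝ E] (hlip : ∀ t, LipschitzWith K (v t))
    (hX : ∀ t x, HasDerivAt (fun τ => X τ x) (v t (X t x)) t) (hX0 : ∀ x, X 0 x = x)
    (hfx : ∀ t, ContDiff ℝ 2 (f t))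
    (hft : ∀ t x, HasDerivAt (fun s => f s x) (-(fderiv ℝ (f t) x (v t x)) - q t x) t)
    (hq : Continuous (Function.uncurry q)) (t : ℝ) (x : E) :
    HasDerivAt (fun s => f s (X s x)) (-(q t (X t x))) t := by
  have : CompleteSpace E := FiniteDimensional.complete ℝ E
  have : ProperSpace E := FiniteDimensional.proper_real E
  have hfc : ∀ x, Continuous fun t => f t x := fun x =>
    continuous_iff_continuousAt.2 fun t => (hft t x).continuousAt
  have hd : ∀ t, Differentiable ℝ (f t) := fun t => (hfx t).differentiable (by norm_num)
  suffices h : HasDerivAt (flowInvariant f q X x) 0 t by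
    have := h.sub (hasDerivAt_integral_flow hX hq x t)
    simpa [flowInvariant, Pi.sub_def] using this
  set r : ℝ := ‖x‖ + 1
  set G : Set ℝ := {t | ∀ y : Metric.ball (0 : E) r, HasDerivAt (flowInvariant f q X y) 0 t}
  suffices h : interior G = Set.univ from
    interior_subset (h ▸ Set.mem_univ t : t ∈ interior G) ⟨x, by simp [r]⟩
  by_contra hne
  obtain ⟨t₀, ht₀⟩ := (Set.ne_univ_iff_exists_notMem _).1 hne
  set F : Set ℝ := (interior G)ᶜ
  have hF : IsClosed F := isOpen_interior.isClosed_compl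
  obtain ⟨R, hR⟩ : ∃ R, ∀ s ∈ Set.Icc (t₀ - 1) (t₀ + 1), ∀ y ∈ Metric.ball (0 : E) r,
      X s y ∈ Metric.ball (0 : E) R := by
    obtain ⟨C, hC⟩ := ((isCompact_Icc (a := t₀ - 1) (b := t₀ + 1)).prod
      (isCompact_closedBall (0 : E) r)).exists_bound_of_continuousOn
      (continuous_uncurry_flow hlip hX hX0).continuousOn
    refine ⟨C + 1, fun s hs y hy => ?_⟩
    have := hC (s, y) ⟨hs, Metric.ball_subset_closedBall hy⟩
    rw [mem_ball_zero_iff]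
    exact lt_of_le_of_lt this (lt_add_one C)
  have : CompleteSpace F := hF.completeSpace_coe
  have hdense : Dense (⋃ n : ℕ, interior
      {s : F | SegmentBound (n : ℝ) (Metric.ball (0 : E) R) (f s)}) := by
    refine dense_iUnion_interior_of_closed (fun n => ?_) ?_
    · exact (isClosed_setOf_segmentBound hfc n _).preimage continuous_subtype_val
    · refine Set.eq_univ_iff_forall.2 fun s => Set.mem_iUnion.2 ?_
      exact exists_nat_segmentBound (hfx s) R
  obtain ⟨t₁, ht₁, ht₁'⟩ := hdense.inter_open_nonempty
    (Subtype.val ⁻¹' Set.Ioo (t₀ - 1) (t₀ + 1)) (isOpen_Ioo.preimage continuous_subtype_val)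
    ⟨⟨t₀, ht₀⟩, by simp⟩
  obtain ⟨n, hn⟩ := Set.mem_iUnion.1 ht₁'
  obtain ⟨a, b, hab, hsub⟩ : ∃ a b, t₁.1 ∈ Set.Ioo a b ∧ ∀ s ∈ F ∩ Set.Ioo a b,
      s ∈ Set.Icc (t₀ - 1) (t₀ + 1) ∧ SegmentBound n (Metric.ball (0 : E) R) (f s) := by
    have h1 := mem_interior_iff_mem_nhds.1 hn
    rw [nhds_subtype, mem_comap] at h1
    obtain ⟨V, hV, hVs⟩ := h1
    obtain ⟨a, b, hab, hsub⟩ :=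
      mem_nhds_iff_exists_Ioo_subset.1 (inter_mem hV (isOpen_Ioo.mem_nhds ht₁))
    exact ⟨a, b, hab, fun s hs => ⟨Set.Ioo_subset_Icc_self (hsub hs.2).2,
      hVs (show (⟨s, hs.1⟩ : F) ∈ _ from (hsub hs.2).1)⟩⟩
  have hG : Set.Ioo a b ⊆ G := by
    refine hasDerivAt_zero_of_gaps hF (fun S c m hS hc y => ?_) (fun s hs => ?_)
      (fun s hs y => ?_)
    · exact flowInvariant_eq_of_mem_closure hlip hX hX0 (fun t => (hd t).continuous) hfc hq
        Metric.isOpen_ball (fun τ hτ z hz => hS τ hτ ⟨z, hz⟩) hc y.2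
    · exact interior_subset (not_not.1 hs : s ∈ interior G)
    · have hbd : ∀ᶠ τ in 𝓝[F] s, SegmentBound n (Metric.ball (0 : E) R) (f τ) := by
        filter_upwards [inter_mem_nhdsWithin F (isOpen_Ioo.mem_nhds hs.2)] with τ hτ
        exact (hsub τ hτ).2
      have h1 := hasDerivWithinAt_comp_of_segmentBound Metric.isOpen_ball hs.1 hbd hd hfc
        (hX s y) (hR s (hsub s hs).1 y y.2) (hft s (X s y))
      have hcancel : ∀ α β : ℝ, 0 = -α - β + α + β := fun α β => by ring
      have h2 := h1.add (hasDerivAt_integral_flow hX hq y s).hasDerivWithinAt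
      rw [← hcancel] at h2
      exact h2
  exact t₁.2 (interior_maximal hG isOpen_Ioo hab)

end Transport

section Gradient

variable {E : Type*} [NormedAddCommGroup E] [NormedSpace ℝ E]
  {E' : Type*} [NormedAddCommGroup E'] [NormedSpace ℝ E']
  {v : ℝ → E → E} {X : ℝ → E → E} {K : NNReal} {f q : ℝ → E → ℝ}

theorem hasFDerivAt_of_contDiff_uncurry {w : ℝ → E → E'}
    (hw : ContDiff ℝ 1 (Function.uncurry w)) (t : ℝ) (p : E) :
    HasFDerivAt (w t) ((fderiv ℝ (Function.uncurry w) (t, p)).comp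
      (ContinuousLinearMap.inr ℝ ℝ E)) p :=
  HasFDerivAt.comp (g := Function.uncurry w) p
    ((hw.differentiable (by norm_num)) (t, p)).hasFDerivAt (hasFDerivAt_prodMk_right t p)

theorem exists_norm_sub_sub_fderiv_le {w : ℝ → E → E'} (hw : ContDiff ℝ 1 (Function.uncurry w))
    (t : ℝ) (p : E) {ε : ℝ} (hε : 0 < ε) :
    ∃ η > 0, ∀ s, |s - t| < η → ∀ y ∈ Metric.ball p η, ∀ z ∈ Metric.ball p η,
      ‖w s y - w s z - fderiv ℝ (w t) p (y - z)‖ ≤ ε * ‖y - z‖ := by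
  have hstrict := (hw.contDiffAt (x := (t, p))).hasStrictFDerivAt (by norm_num)
  have hev := Asymptotics.isLittleO_iff.1 hstrict.isLittleO hε
  rw [Metric.eventually_nhds_iff] at hev
  obtain ⟨η, hη, hev⟩ := hev
  refine ⟨η, hη, fun s hs y hy z hz => ?_⟩
  have := hev (y := ((s, y), (s, z))) (by
    simp only [Prod.dist_eq, max_lt_iff, Real.dist_eq]
    exact ⟨⟨hs, hy⟩, hs, hz⟩)
  rw [(hasFDerivAt_of_contDiff_uncurry hw t p).fderiv]
  simpa [Prod.norm_def] using this

theorem exists_norm_primitive_flow_sub_le (hlip : ∀ t, LipschitzWith K (v t))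
    (hX : ∀ t x, HasDerivAt (fun τ => X τ x) (v t (X t x)) t) {w : ℝ → E → E'}
    (hw : ContDiff ℝ 1 (Function.uncurry w)) (t : ℝ) (x : E) {ε : ℝ} (hε : 0 < ε) :
    ∃ η > 0, ∀ s, |s - t| < η → ∀ y, ‖X t y - X t x‖ < η → ∀ φ : ℝ → E',
      (∀ τ, HasDerivAt φ (w τ (X τ y) - w τ (X τ x)) τ) →
      ‖φ s - φ t - (s - t) • fderiv ℝ (w t) (X t x) (X t y - X t x)‖
        ≤ ε * ‖X t y - X t x‖ * |s - t| := by
  set W := fderiv ℝ (w t) (X t x)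
  set C := Real.exp K
  have hC : 0 < C := Real.exp_pos _
  obtain ⟨η₁, hη₁, hW⟩ := exists_norm_sub_sub_fderiv_le hw t (X t x)
    (show 0 < ε / (2 * C) by positivity)
  obtain ⟨η₂, hη₂, hXx⟩ := Metric.continuousAt_iff.1 (hX t x).continuousAt (η₁ / 2) (half_pos hη₁)
  set A := ‖W‖ * K * C
  have hA : 0 ≤ A := by positivity
  refine ⟨min (min η₁ η₂) (min (min 1 (η₁ / (2 * C))) (ε / (2 * (A + 1)))), by positivity,
    fun s hs y hy φ hφ => ?_⟩
  simp only [lt_min_iff] at hs hy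
  obtain ⟨⟨hs1, hs2⟩, ⟨hs3, -⟩, hs4⟩ := hs
  obtain ⟨-, ⟨-, hy1⟩, -⟩ := hy
  set u := X t y - X t x with hu
  have hD : ∀ τ ∈ Set.uIcc t s, ‖X τ y - X τ x‖ ≤ C * ‖u‖ := by
    intro τ hτ
    have hle : |τ - t| ≤ 1 := (Set.abs_sub_left_of_mem_uIcc hτ).trans hs3.le
    refine (norm_flow_sub_flow_le hlip hX t τ y x).trans ?_
    rw [mul_comm]
    refine mul_le_mul_of_nonneg_right (Real.exp_le_exp.2 ?_) (norm_nonneg _)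
    exact mul_le_of_le_one_right K.2 hle
  have hDu : ∀ τ ∈ Set.uIcc t s, ‖X τ y - X τ x - u‖ ≤ K * (C * ‖u‖) * |s - t| := by
    intro τ hτ
    have := (convex_uIcc t s).norm_image_sub_le_of_norm_hasDerivWithin_le
      (f := fun τ => X τ y - X τ x) (f' := fun τ => v τ (X τ y) - v τ (X τ x))
      (C := K * (C * ‖u‖)) (fun τ _ => ((hX τ y).sub (hX τ x)).hasDerivWithinAt)
      (fun τ hτ => ((hlip τ).norm_sub_le _ _).trans
        (mul_le_mul_of_nonneg_left (hD τ hτ) K.2)) Set.left_mem_uIcc hτ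
    refine this.trans (mul_le_mul_of_nonneg_left ?_ (by positivity))
    exact Set.abs_sub_left_of_mem_uIcc hτ
  have hφ' : ∀ τ ∈ Set.uIcc t s, ‖w τ (X τ y) - w τ (X τ x) - W u‖ ≤ ε * ‖u‖ := by
    intro τ hτ
    have hτs : |τ - t| ≤ |s - t| := Set.abs_sub_left_of_mem_uIcc hτ
    have hx1 : dist (X τ x) (X t x) < η₁ / 2 := hXx (lt_of_le_of_lt hτs hs2)
    have hDlt : ‖X τ y - X τ x‖ < η₁ / 2 := by
      refine (hD τ hτ).trans_lt ?_
      rw [lt_div_iff₀ (by positivity)] at hy1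
      linarith
    have hy2 : dist (X τ y) (X t x) < η₁ := by
      have := dist_triangle (X τ y) (X τ x) (X t x)
      rw [dist_eq_norm (X τ y) (X τ x)] at this
      linarith
    have h1 := hW τ (hτs.trans_lt hs1) (X τ y) hy2 (X τ x)
      (Metric.mem_ball.2 (hx1.trans (half_lt_self hη₁)))
    have h2 : ‖W (X τ y - X τ x - u)‖ ≤ ‖W‖ * (K * (C * ‖u‖) * |s - t|) :=
      (W.le_opNorm _).trans (mul_le_mul_of_nonneg_left (hDu τ hτ) (norm_nonneg _))
    have h3 : ε / (2 * C) * ‖X τ y - X τ x‖ ≤ ε / 2 * ‖u‖ := by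
      calc _ ≤ ε / (2 * C) * (C * ‖u‖) := by gcongr; exact hD τ hτ
        _ = _ := by field_simp
    have h4 : ‖W‖ * (K * (C * ‖u‖) * |s - t|) ≤ ε / 2 * ‖u‖ := by
      have h5 : A * |s - t| ≤ ε / 2 := by
        rw [lt_div_iff₀ (by positivity)] at hs4
        nlinarith [abs_nonneg (s - t)]
      calc _ = (A * |s - t|) * ‖u‖ := by simp only [A]; ring
        _ ≤ _ := by gcongr
    calc ‖w τ (X τ y) - w τ (X τ x) - W u‖
        = ‖(w τ (X τ y) - w τ (X τ x) - W (X τ y - X τ x)) + W (X τ y - X τ x - u)‖ := by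
          rw [map_sub W (X τ y - X τ x) u, sub_add_sub_cancel]
      _ ≤ ε / 2 * ‖u‖ + ε / 2 * ‖u‖ :=
          (norm_add_le _ _).trans (add_le_add (h1.trans h3) (h2.trans h4))
      _ = _ := by ring
  have := (convex_uIcc t s).norm_image_sub_le_of_norm_hasDerivWithin_le
    (f := fun τ => φ τ - (τ - t) • W u) (f' := fun τ => w τ (X τ y) - w τ (X τ x) - W u)
    (C := ε * ‖u‖) (fun τ _ => by
      have h1 : HasDerivAt (fun τ => (τ - t) • W u) (W u) τ := by
        simpa using ((hasDerivAt_id τ).sub_const t).smul_const (W u)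
      exact ((hφ τ).sub h1).hasDerivWithinAt) hφ' Set.left_mem_uIcc Set.right_mem_uIcc
  simp only [sub_self, zero_smul, sub_zero] at this
  rw [sub_right_comm]
  exact this

theorem hasDerivAt_of_norm_comp_sub_le {L : ℝ → E →L[ℝ] ℝ} {J : E →L[ℝ] E} {Λ : E →L[ℝ] ℝ} {t : ℝ}
    (h : ∀ ε > 0, ∀ᶠ s in 𝓝 t, ‖L s + (s - t) • (L s).comp J - L t + (s - t) • Λ‖
      ≤ ε * |s - t| * (1 + ‖L s‖)) :
    HasDerivAt L (-((L t).comp J) - Λ) t := by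
  have hsub : Tendsto (fun s => s - t) (𝓝 t) (𝓝 0) := by
    have : Continuous fun s : ℝ => s - t := by fun_prop
    simpa using this.tendsto t
  set M := 2 * (‖L t‖ + ‖Λ‖ + 1)
  have hbd : ∀ᶠ s in 𝓝 t, ‖L s‖ ≤ M := by
    have h1 : ∀ᶠ s in 𝓝 t, |s - t| < 1 := by
      simpa using hsub.abs.eventually (gt_mem_nhds (by simp : |(0 : ℝ)| < 1))
    have h2 : ∀ᶠ s in 𝓝 t, |s - t| * (1 + ‖J‖) < 1 / 2 :=
      (hsub.abs.mul_const (1 + ‖J‖)).eventually (gt_mem_nhds (by simp))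
    filter_upwards [h 1 one_pos, h1, h2] with s hs h1 h2
    have hdec : L s = (L s + (s - t) • (L s).comp J - L t + (s - t) • Λ)
        + (L t - (s - t) • (L s).comp J - (s - t) • Λ) := by abel
    have hn : ‖(s - t) • (L s).comp J‖ ≤ |s - t| * (‖L s‖ * ‖J‖) := by
      rw [norm_smul, Real.norm_eq_abs]
      gcongr
      exact ContinuousLinearMap.opNorm_comp_le _ _
    have hn' : ‖(s - t) • Λ‖ ≤ ‖Λ‖ := by
      rw [norm_smul, Real.norm_eq_abs]
      exact mul_le_of_le_one_left (norm_nonneg _) h1.le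
    have h3 : ‖L s‖ ≤ 1 * |s - t| * (1 + ‖L s‖) + (‖L t‖ + |s - t| * (‖L s‖ * ‖J‖) + ‖Λ‖) := by
      conv_lhs => rw [hdec]
      refine (norm_add_le _ _).trans (add_le_add hs ?_)
      exact (norm_sub_le _ _).trans (add_le_add ((norm_sub_le _ _).trans
        (add_le_add le_rfl hn)) hn')
    have h4 := mul_le_mul_of_nonneg_right h2.le (norm_nonneg (L s))
    simp only [M]
    nlinarith
  have hA : (fun s => L s + (s - t) • (L s).comp J - L t + (s - t) • Λ) =o[𝓝 t] fun s => s - t := by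
    rw [Asymptotics.isLittleO_iff]
    intro c hc
    have hM : 0 ≤ M := by positivity
    filter_upwards [h (c / (1 + M)) (by positivity), hbd] with s hs hb
    refine hs.trans ?_
    rw [Real.norm_eq_abs]
    calc c / (1 + M) * |s - t| * (1 + ‖L s‖) ≤ c / (1 + M) * |s - t| * (1 + M) := by gcongr
      _ = c * |s - t| := by field_simp
  have hbdJ : (fun s => (s - t) • ((L s).comp J + Λ)) =O[𝓝 t] fun s => s - t := by
    refine Asymptotics.IsBigO.of_bound (M * ‖J‖ + ‖Λ‖) ?_
    filter_upwards [hbd] with s hb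
    rw [norm_smul, mul_comm]
    gcongr
    refine (norm_add_le _ _).trans (add_le_add ?_ le_rfl)
    exact (ContinuousLinearMap.opNorm_comp_le _ _).trans (by gcongr)
  have hlim : (fun s => L s - L t) =o[𝓝 t] fun _ => (1 : ℝ) := by
    refine Asymptotics.IsBigO.trans_isLittleO (g := fun s => s - t) ?_
      ((Asymptotics.isLittleO_one_iff ℝ).2 hsub)
    refine (hA.isBigO.sub hbdJ).congr_left fun s => ?_
    rw [smul_add]
    abel
  have hJ : (fun s => (s - t) • (L s - L t).comp J) =o[𝓝 t] fun s => s - t := by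
    have hc : (fun s => (L s - L t).comp J) =o[𝓝 t] fun _ => (1 : ℝ) := by
      refine Asymptotics.IsBigO.trans_isLittleO (Asymptotics.IsBigO.of_bound ‖J‖ ?_) hlim
      refine Eventually.of_forall fun s => ?_
      rw [mul_comm]
      exact ContinuousLinearMap.opNorm_comp_le _ _
    simpa using (Asymptotics.isBigO_refl (fun s => s - t) (𝓝 t)).smul_isLittleO hc
  rw [hasDerivAt_iff_isLittleO]
  refine (hA.sub hJ).congr_left fun s => ?_
  rw [ContinuousLinearMap.sub_comp, smul_sub, smul_sub, smul_neg]
  abel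

theorem hasDerivAt_fderiv_comp_flow [FiniteDimensional ℝ E] (hlip : ∀ t, LipschitzWith K (v t))
    (hX : ∀ t x, HasDerivAt (fun τ => X τ x) (v t (X t x)) t) (hX0 : ∀ x, X 0 x = x)
    (hv : ContDiff ℝ 1 (Function.uncurry v)) (hq : ContDiff ℝ 1 (Function.uncurry q))
    (hfx : ∀ t, ContDiff ℝ 2 (f t))
    (hft : ∀ t x, HasDerivAt (fun s => f s x) (-(fderiv ℝ (f t) x (v t x)) - q t x) t)
    (t : ℝ) (x : E) :
    HasDerivAt (fun s => fderiv ℝ (f s) (X s x))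
      (-((fderiv ℝ (f t) (X t x)).comp (fderiv ℝ (v t) (X t x))) - fderiv ℝ (q t) (X t x)) t := by
  have : CompleteSpace E := FiniteDimensional.complete ℝ E
  have hd : ∀ t, Differentiable ℝ (f t) := fun t => (hfx t).differentiable (by norm_num)
  have hflow := hasDerivAt_comp_flow hlip hX hX0 hfx hft hq.continuous
  choose Y hY using fun u => flow_surjective hlip hX hX0 t (X t x + u)
  have hYu : ∀ u, X t (Y u) - X t x = u := fun u => by rw [hY, add_sub_cancel_left]
  have hDle : ∀ s u, ‖X s (Y u) - X s x‖ ≤ ‖u‖ * Real.exp (K * |s - t|) := fun s u => by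
    simpa only [hYu] using norm_flow_sub_flow_le hlip hX t s (Y u) x
  refine hasDerivAt_of_norm_comp_sub_le fun ε hε => ?_
  obtain ⟨η₁, hη₁, hv'⟩ := exists_norm_primitive_flow_sub_le hlip hX hv t x hε
  obtain ⟨η₂, hη₂, hq'⟩ := exists_norm_primitive_flow_sub_le hlip hX
    (w := fun t x => -(q t x)) hq.neg t x hε
  filter_upwards [Metric.ball_mem_nhds t (lt_min hη₁ hη₂)] with s hs
  have hs' : |s - t| < min η₁ η₂ := hs
  rw [lt_min_iff] at hs'
  set L := fderiv ℝ (f s) (X s x)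
  set J := fderiv ℝ (v t) (X t x)
  set Λ := fderiv ℝ (q t) (X t x)
  refine le_of_forall_pos_le_add fun δ hδ => ?_
  refine ContinuousLinearMap.opNorm_le_of_nhds_zero (by positivity) ?_
  set C := Real.exp (K * |s - t|)
  have hC : 0 < C := Real.exp_pos _
  have hDlim : Tendsto (fun u => X s (Y u)) (𝓝 0) (𝓝 (X s x)) := by
    rw [tendsto_iff_norm_sub_tendsto_zero]
    refine squeeze_zero (fun _ => norm_nonneg _) (hDle s) ?_
    have : Continuous fun u : E => ‖u‖ * C := by fun_prop
    simpa using this.tendsto 0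
  have h1 : ∀ᶠ u in 𝓝 (0 : E), ‖f s (X s (Y u)) - f s (X s x) - L (X s (Y u) - X s x)‖
      ≤ δ / (2 * C) * ‖X s (Y u) - X s x‖ :=
    hDlim.eventually (Asymptotics.isLittleO_iff.1
      (hasFDerivAt_iff_isLittleO.1 (hd s (X s x)).hasFDerivAt) (by positivity))
  have h2 : ∀ᶠ u in 𝓝 (0 : E), ‖f t (X t x + u) - f t (X t x) - fderiv ℝ (f t) (X t x) u‖
      ≤ δ / 2 * ‖u‖ :=
    Asymptotics.isLittleO_iff.1 (hasFDerivAt_iff_isLittleO_nhds_zero.1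
      (hd t (X t x)).hasFDerivAt) (by positivity)
  filter_upwards [h1, h2, Metric.ball_mem_nhds (0 : E) (lt_min hη₁ hη₂)] with u h1 h2 hu
  rw [mem_ball_zero_iff, lt_min_iff] at hu
  have h3 := hv' s hs'.1 (Y u) (by rw [hYu]; exact hu.1) (fun τ => X τ (Y u) - X τ x)
    (fun τ => (hX τ _).sub (hX τ _))
  have h4 := hq' s hs'.2 (Y u) (by rw [hYu]; exact hu.2)
    (fun τ => f τ (X τ (Y u)) - f τ (X τ x)) (fun τ => (hflow τ _).sub (hflow τ _))
  simp only [hYu] at h3 h4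
  rw [fderiv_fun_neg] at h4
  simp only [hY] at h4
  have h5 : δ / (2 * C) * ‖X s (Y u) - X s x‖ ≤ δ / 2 * ‖u‖ := by
    calc _ ≤ δ / (2 * C) * (‖u‖ * C) := by gcongr; exact hDle s u
      _ = _ := by field_simp
  set D := X s (Y u) - X s x
  have h6 : ‖L (D - u - (s - t) • J u)‖ ≤ ‖L‖ * (ε * ‖u‖ * |s - t|) :=
    (L.le_opNorm _).trans (by gcongr)
  have hid : (L + (s - t) • L.comp J - fderiv ℝ (f t) (X t x) + (s - t) • Λ) u
      = (f s (X s (Y u)) - f s (X s x) - (f t (X t x + u) - f t (X t x)) - (s - t) • (-Λ) u)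
        - (f s (X s (Y u)) - f s (X s x) - L D)
        + (f t (X t x + u) - f t (X t x) - fderiv ℝ (f t) (X t x) u)
        - L (D - u - (s - t) • J u) := by
    simp only [map_sub, map_smul, _root_.add_apply, _root_.sub_apply,
      _root_.smul_apply, ContinuousLinearMap.comp_apply,
      _root_.neg_apply, smul_eq_mul]
    ring
  rw [hid]
  calc _ ≤ ε * ‖u‖ * |s - t| + δ / 2 * ‖u‖ + δ / 2 * ‖u‖ + ‖L‖ * (ε * ‖u‖ * |s - t|) :=
        (norm_sub_le _ _).trans (add_le_add ((norm_add_le _ _).trans (add_le_add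
          ((norm_sub_le _ _).trans (add_le_add h4 (h1.trans h5))) h2)) h6)
    _ = _ := by ring

end Gradient

section Fields

variable {d : ℕ}

theorem contDiff_uncurry_dvg {v : ℝ → (Fin d → ℝ) → (Fin d → ℝ)}
    (hv : ContDiff ℝ 2 (Function.uncurry v)) :
    ContDiff ℝ 1 (Function.uncurry fun t x => dvg (v t) x) := by
  have h : (Function.uncurry fun t x => dvg (v t) x)
      = fun p => ∑ i, fderiv ℝ (Function.uncurry v) p (0, Pi.single i 1) i := by
    ext ⟨t, x⟩
    simp [dvg, (hasFDerivAt_of_contDiff_uncurry (hv.of_le (by norm_num)) t x).fderiv]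
  rw [h]
  have hd : ContDiff ℝ 1 (fderiv ℝ (Function.uncurry v)) := hv.fderiv_right (by norm_num)
  exact ContDiff.sum fun i _ => contDiff_pi.1 (hd.clm_apply contDiff_const) i

theorem dvg_smul {h : (Fin d → ℝ) → ℝ} {F : (Fin d → ℝ) → (Fin d → ℝ)} {x : Fin d → ℝ}
    (hh : DifferentiableAt ℝ h x) (hF : DifferentiableAt ℝ F x) :
    dvg (fun y => h y • F y) x = h x * dvg F x + fderiv ℝ h x (F x) := by
  have h2 : fderiv ℝ h x (F x) = ∑ i, fderiv ℝ h x (Pi.single i 1) * F x i := by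
    conv_lhs => rw [← Finset.univ_sum_single (F x), map_sum]
    refine Finset.sum_congr rfl fun i _ => ?_
    have : Pi.single i (F x i) = F x i • (Pi.single i 1 : Fin d → ℝ) := by
      rw [← Pi.single_smul, smul_eq_mul, mul_one]
    rw [this, map_smul, smul_eq_mul, mul_comm]
  rw [h2, dvg, fderiv_fun_smul hh hF, dvg, Finset.mul_sum, ← Finset.sum_add_distrib]
  simp

theorem jac_transpose_mulVec_grad (h : (Fin d → ℝ) → ℝ) (F : (Fin d → ℝ) → (Fin d → ℝ))
    (x y : Fin d → ℝ) (i : Fin d) :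
    (jac F x)ᵀ.mulVec (grad h y) i = fderiv ℝ h y (fderiv ℝ F x (Pi.single i 1)) := by
  conv_rhs => rw [← Finset.univ_sum_single (fderiv ℝ F x (Pi.single i 1)), map_sum]
  simp only [Matrix.mulVec, dotProduct, Matrix.transpose_apply, jac, Matrix.of_apply, grad]
  refine Finset.sum_congr rfl fun j _ => ?_
  rw [← smul_eq_mul, ← map_smul, ← Pi.single_smul, smul_eq_mul, mul_one]

end Fields

theorem stmt_3 (d : ℕ) (hd : 1 ≤ d)
    (v : ℝ → (Fin d → ℝ) → (Fin d → ℝ))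
    (ρ : ℝ → (Fin d → ℝ) → ℝ)
    (X : ℝ → (Fin d → ℝ) → (Fin d → ℝ))
    -- `v` is C² in `t` and `x` jointly and globally Lipschitz in `x`
    (hv : ContDiff ℝ 2 (Function.uncurry v))
    (hvlip : ∃ K : NNReal, ∀ t, LipschitzWith K (v t))
    -- `ρ` is an everywhere-positive probability density, C¹ in `t`, C³ in `x`
    (hρpos : ∀ t x, 0 < ρ t x)
    (hρprob : ∀ t, (∫ x, ρ t x) = 1)
    (hρt : ∀ x, ContDiff ℝ 1 (fun t => ρ t x))
    (hρx : ∀ t, ContDiff ℝ 3 (ρ t))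
    -- transport equation
    (hTE : ∀ t x, deriv (fun τ => ρ τ x) t = - dvg (fun y => ρ t y • v t y) x)
    -- probability flow
    (hX0 : ∀ x, X 0 x = x)
    (hXflow : ∀ t x, HasDerivAt (fun τ => X τ x) (v t (X t x)) t) :
    ∀ x : Fin d → ℝ,
      (∀ t : ℝ,
        HasDerivAt (fun τ => grad (fun y => Real.log (ρ τ y)) (X τ x))
          (-((jac (v t) (X t x))ᵀ.mulVec (grad (fun y => Real.log (ρ t y)) (X t x)))
            - grad (fun y => dvg (v t) y) (X t x)) t)
      ∧ grad (fun y => Real.log (ρ 0 y)) (X 0 x)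
          = grad (fun y => Real.log (ρ 0 y)) x := by
  obtain ⟨K, hlip⟩ := hvlip
  have hv1 : ContDiff ℝ 1 (Function.uncurry v) := hv.of_le (by norm_num)
  have hlog : ∀ t x, HasDerivAt (fun s => Real.log (ρ s x))
      (-(fderiv ℝ (fun y => Real.log (ρ t y)) x (v t x)) - dvg (v t) x) t := by
    intro t x
    have hρd : DifferentiableAt ℝ (ρ t) x := (hρx t).differentiable (by norm_num) x
    have h1 : HasDerivAt (fun s => ρ s x) (deriv (fun s => ρ s x) t) t :=
      ((hρt x).differentiable (by norm_num) t).hasDerivAt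
    have h2 := h1.log (hρpos t x).ne'
    rw [hTE, dvg_smul hρd (hasFDerivAt_of_contDiff_uncurry hv1 t x).differentiableAt] at h2
    convert h2 using 1
    rw [(hρd.hasFDerivAt.log (hρpos t x).ne').fderiv]
    have := (hρpos t x).ne'
    simp only [_root_.smul_apply, smul_eq_mul]
    field_simp
    ring
  refine fun x => ⟨fun t => hasDerivAt_pi.2 fun i => ?_, by rw [hX0]⟩
  have h := hasDerivAt_fderiv_comp_flow hlip hXflow hX0 hv1 (contDiff_uncurry_dvg hv)
    (fun t => ((hρx t).log fun x => (hρpos t x).ne').of_le (by norm_num)) hlog t x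
  rw [Pi.sub_apply, Pi.neg_apply, jac_transpose_mulVec_grad]
  simpa [grad] using h.clm_apply (hasDerivAt_const t (Pi.single i 1))
end
end
end

section
/- Let v_t : ℝ^d → ℝ^d be C² in both t and x and globally Lipschitz in x, let ρ_t be an everywhere-positive C¹-in-t, C³-in-x probability density solving the transport equation ∂_t ρ_t(x) = −∇·(v_t(x) ρ_t(x)), and let X_{0,t}(x) be the flow of v with X_{0,0}(x) = x. Assume the differential entropy H_t = −∫_{ℝ^d} log ρ_t(x) ρ_t(x) dx is finite for all t. Then for all t ≥ 0, H_t = H_0 + ∫_0^t ∫_{ℝ^d} ∇·v_τ(X_{0,τ}(x)) ρ_0(x) dx dτ. -/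
open MeasureTheory Matrix Filter
open scoped Topology

noncomputable section

section Flow

variable {E : Type*} [NormedAddCommGroup E] [NormedSpace ℝ E]

theorem dist_trajectories_le_of_nonneg {v : ℝ → E → E} {K : NNReal}
    (hv : ∀ t, LipschitzWith K (v t)) {f g : ℝ → E}
    (hf : ∀ t, HasDerivAt f (v t (f t)) t) (hg : ∀ t, HasDerivAt g (v t (g t)) t)
    {t : ℝ} (ht : 0 ≤ t) :
    dist (f t) (g t) ≤ dist (f 0) (g 0) * Real.exp (K * t) := by
  have h := dist_le_of_trajectories_ODE (a := 0) (b := t) hv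
    (fun s _ => (hf s).continuousAt.continuousWithinAt) (fun s _ => (hf s).hasDerivWithinAt)
    (fun s _ => (hg s).continuousAt.continuousWithinAt) (fun s _ => (hg s).hasDerivWithinAt)
    le_rfl t ⟨ht, le_rfl⟩
  simpa using h

theorem dist_trajectories_le {v : ℝ → E → E} {K : NNReal}
    (hv : ∀ t, LipschitzWith K (v t)) {f g : ℝ → E}
    (hf : ∀ t, HasDerivAt f (v t (f t)) t) (hg : ∀ t, HasDerivAt g (v t (g t)) t) (t : ℝ) :
    dist (f t) (g t) ≤ dist (f 0) (g 0) * Real.exp (K * |t|) := by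
  rcases le_total 0 t with ht | ht
  · simpa [abs_of_nonneg ht] using dist_trajectories_le_of_nonneg hv hf hg ht
  · have reverse : ∀ {f : ℝ → E}, (∀ t, HasDerivAt f (v t (f t)) t) →
        ∀ s, HasDerivAt (fun s => f (-s)) (-v (-s) (f (-s))) s := fun hf s => by
      simpa [Function.comp_def] using (hf (-s)).scomp s (hasDerivAt_neg s)
    simpa [abs_of_nonpos ht] using dist_trajectories_le_of_nonneg (v := fun s y => -v (-s) y)
      (fun s => (hv (-s)).neg) (reverse hf) (reverse hg) (neg_nonneg.2 ht)

variable {v : ℝ → E → E} {K : NNReal} {X : ℝ → E → E}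

theorem lipschitzWith_flow (hv : ∀ t, LipschitzWith K (v t)) (hX0 : ∀ x, X 0 x = x)
    (hX : ∀ t x, HasDerivAt (fun τ => X τ x) (v t (X t x)) t) (t : ℝ) :
    LipschitzWith (Real.toNNReal (Real.exp (K * |t|))) (X t) := by
  refine LipschitzWith.of_dist_le_mul fun x y => ?_
  rw [Real.coe_toNNReal _ (Real.exp_pos _).le, mul_comm]
  simpa [hX0] using dist_trajectories_le hv (hX · x) (hX · y) t

theorem injective_flow (hv : ∀ t, LipschitzWith K (v t)) (hX0 : ∀ x, X 0 x = x)
    (hX : ∀ t x, HasDerivAt (fun τ => X τ x) (v t (X t x)) t) (t : ℝ) :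
    Function.Injective (X t) := fun x y hxy => by
  have h := ODE_solution_unique_univ (s := fun _ => Set.univ) (fun s => (hv s).lipschitzOnWith)
    (fun s => ⟨hX s x, trivial⟩) (fun s => ⟨hX s y, trivial⟩) hxy
  simpa [hX0] using congrFun h 0

theorem continuous_flow (hv : ∀ t, LipschitzWith K (v t)) (hX0 : ∀ x, X 0 x = x)
    (hX : ∀ t x, HasDerivAt (fun τ => X τ x) (v t (X t x)) t) :
    Continuous (Function.uncurry X) := by
  refine continuous_iff_continuousAt.2 fun p => ?_
  have h : ContinuousOn (Function.uncurry X) (Metric.ball 0 (|p.1| + 1) ×ˢ Set.univ) := by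
    refine continuousOn_prod_of_continuousOn_lipschitzOnWith' _
      (Real.toNNReal (Real.exp (K * (|p.1| + 1)))) (fun t ht => ?_)
      (fun x _ t _ => (hX t x).continuousAt.continuousWithinAt)
    refine ((lipschitzWith_flow hv hX0 hX t).weaken ?_).lipschitzOnWith
    have : |t| ≤ |p.1| + 1 := by simpa using (Metric.mem_ball.1 ht).le
    gcongr
  refine h.continuousAt (prod_mem_nhds (Metric.isOpen_ball.mem_nhds ?_) univ_mem)
  simp

theorem flow_eq_add_integral [CompleteSpace E] (hv : Continuous (Function.uncurry v))
    (hX0 : ∀ x, X 0 x = x)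
    (hX : ∀ t x, HasDerivAt (fun τ => X τ x) (v t (X t x)) t) (t : ℝ) (x : E) :
    X t x = x + ∫ τ in (0 : ℝ)..t, v τ (X τ x) := by
  have hc : Continuous fun τ => X τ x :=
    continuous_iff_continuousAt.2 fun τ => (hX τ x).continuousAt
  have hi : Continuous fun τ => v τ (X τ x) := hv.comp (continuous_id.prodMk hc)
  rw [intervalIntegral.integral_eq_sub_of_hasDerivAt (fun τ _ => hX τ x)
    (hi.intervalIntegrable _ _), hX0]
  abel

theorem continuous_fderiv_of_uncurry (hvc : ContDiff ℝ 1 (Function.uncurry v)) :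
    Continuous fun p : ℝ × E => fderiv ℝ (v p.1) p.2 :=
  (ContDiff.fderiv (n := 0) (f := fun p : ℝ × E => v p.1)
    (hvc.comp ((contDiff_fst.comp contDiff_fst).prodMk contDiff_snd)) contDiff_snd le_rfl).continuous

/-- At a point where almost every time-`τ` flow map is differentiable, every time-`t` flow map has
a line derivative, given by the linearised integral equation. -/
theorem hasDerivAt_flow_line [FiniteDimensional ℝ E] [MeasurableSpace E] [BorelSpace E]
    (hvc : ContDiff ℝ 1 (Function.uncurry v)) (hv : ∀ t, LipschitzWith K (v t))
    (hX0 : ∀ x, X 0 x = x)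
    (hX : ∀ t x, HasDerivAt (fun τ => X τ x) (v t (X t x)) t) {x : E}
    (hx : ∀ᵐ τ : ℝ, DifferentiableAt ℝ (X τ) x) (e : E) (t : ℝ) :
    IntervalIntegrable (fun τ => fderiv ℝ (v τ) (X τ x) (fderiv ℝ (X τ) x e)) volume 0 t ∧
    HasDerivAt (fun h : ℝ => X t (x + h • e))
      (e + ∫ τ in (0 : ℝ)..t, fderiv ℝ (v τ) (X τ x) (fderiv ℝ (X τ) x e)) 0 := by
  have := FiniteDimensional.complete ℝ E
  have := FiniteDimensional.proper ℝ E
  have hXc := continuous_flow hv hX0 hX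
  have hF : ∀ h : ℝ, Continuous fun τ => v τ (X τ (x + h • e)) := fun h =>
    hvc.continuous.comp (continuous_id.prodMk (hXc.comp (continuous_id.prodMk continuous_const)))
  have hDv : Continuous fun τ => fderiv ℝ (v τ) (X τ x) :=
    (continuous_fderiv_of_uncurry hvc).comp
      (continuous_id.prodMk (hXc.comp (continuous_id.prodMk continuous_const)))
  have hmeas : Measurable fun τ => fderiv ℝ (X τ) x e :=
    (measurable_fderiv_apply_const_with_param ℝ hXc e).comp (measurable_id.prodMk measurable_const)
  have key := intervalIntegral.hasDerivAt_integral_of_dominated_loc_of_lip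
    (μ := volume) (a := 0) (b := t) (F := fun (h : ℝ) τ => v τ (X τ (x + h • e)))
    (F' := fun τ => fderiv ℝ (v τ) (X τ x) (fderiv ℝ (X τ) x e)) (x₀ := 0) (s := Set.univ)
    (bound := fun τ => K * Real.exp (K * |τ|) * ‖e‖) univ_mem
    (.of_forall fun h => (hF h).aestronglyMeasurable)
    ((hF 0).intervalIntegrable _ _)
    (by
      have hm : Measurable fun τ => fderiv ℝ (v τ) (X τ x) (fderiv ℝ (X τ) x e) := by
        have h2 : Continuous fun q : (E →L[ℝ] E) × E => q.1 q.2 := by fun_prop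
        exact h2.measurable.comp (hDv.measurable.prodMk hmeas)
      exact hm.aestronglyMeasurable)
    (.of_forall fun τ _ => by
      refine LipschitzWith.lipschitzOnWith (LipschitzWith.of_dist_le_mul fun a b => ?_)
      have h1 := (hv τ).dist_le_mul (X τ (x + a • e)) (X τ (x + b • e))
      have h2 := (lipschitzWith_flow hv hX0 hX τ).dist_le_mul (x + a • e) (x + b • e)
      rw [Real.coe_toNNReal _ (Real.exp_pos _).le] at h2
      have h3 : dist (x + a • e) (x + b • e) = ‖e‖ * dist a b := by
        rw [dist_add_left, dist_eq_norm, ← sub_smul, norm_smul, mul_comm, ← dist_eq_norm]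
      rw [h3] at h2
      rw [Real.coe_nnabs, abs_of_nonneg (by positivity)]
      calc _ ≤ _ := h1
        _ ≤ K * (Real.exp (K * |τ|) * (‖e‖ * dist a b)) := by gcongr
        _ = _ := by ring)
    (Continuous.intervalIntegrable (by fun_prop) _ _)
    (by
      filter_upwards [hx] with τ hτ _
      have hl : HasDerivAt (fun h : ℝ => x + h • e) e 0 := by
        simpa using ((hasDerivAt_id (0 : ℝ)).smul_const e).const_add x
      have h0 : x + (0 : ℝ) • e = x := by simp
      have h1 : HasDerivAt (fun h : ℝ => X τ (x + h • e)) (fderiv ℝ (X τ) x e) 0 :=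
        HasFDerivAt.comp_hasDerivAt (0 : ℝ) (by rw [h0]; exact hτ.hasFDerivAt) hl
      have hd : DifferentiableAt ℝ (v τ) (X τ x) := by
        have := (hvc.comp (contDiff_const.prodMk contDiff_id) : ContDiff ℝ 1 fun y : E => v τ y)
        exact (this.differentiable one_ne_zero) _
      exact HasFDerivAt.comp_hasDerivAt (0 : ℝ) (by rw [h0]; exact hd.hasFDerivAt) h1)
  refine ⟨key.1, ?_⟩
  have heq : (fun h : ℝ => X t (x + h • e)) =
      fun h => (x + h • e) + ∫ τ in (0 : ℝ)..t, v τ (X τ (x + h • e)) :=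
    funext fun h => flow_eq_add_integral hvc.continuous hX0 hX t _
  rw [heq]
  have hl : HasDerivAt (fun h : ℝ => x + h • e) e 0 := by
    simpa using ((hasDerivAt_id (0 : ℝ)).smul_const e).const_add x
  exact hl.add key.2

end Flow

/-- Liouville's formula for a matrix solution of a linear ODE. -/
theorem Matrix.hasDerivAt_det_of_linear_ode {n : Type*} [Fintype n] [DecidableEq n]
    {N : ℝ → Matrix n n ℝ} {A : Matrix n n ℝ} {t : ℝ}
    (hN : ∀ i j, HasDerivAt (fun s => N s i j) ((A * N t) i j) t) :
    HasDerivAt (fun s => (N s).det) (A.trace * (N t).det) t := by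
  let D : ContinuousMultilinearMap ℝ (fun _ : n => n → ℝ) ℝ :=
    { (Matrix.detRowAlternating (R := ℝ) (n := n)).toMultilinearMap with
      cont := Continuous.matrix_det continuous_id }
  have hN' : HasDerivAt (fun s => (N s : n → n → ℝ)) (fun i => (A * N t) i) t :=
    hasDerivAt_pi.2 fun i => hasDerivAt_pi.2 fun j => hN i j
  have h := (D.hasFDerivAt (N t)).comp_hasDerivAt t hN'
  refine h.congr_deriv ((D.linearDeriv_apply _ _).trans ?_)
  rw [Matrix.trace, Finset.sum_mul]
  refine Finset.sum_congr rfl fun i _ => ?_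
  have h1 : (A * N t) i = ∑ k, A i k • N t k := by
    ext j; simp [Matrix.mul_apply, Finset.sum_apply]
  rw [h1]
  exact Matrix.det_updateRow_sum (N t) i (A i)

theorem eq_mul_exp_integral_of_hasDerivAt {f a : ℝ → ℝ} (ha : Continuous a)
    (hf : ∀ t, HasDerivAt f (a t * f t) t) (t : ℝ) :
    f t = f 0 * Real.exp (∫ τ in (0 : ℝ)..t, a τ) := by
  have hg : ∀ s, HasDerivAt (fun s => f s * Real.exp (-∫ τ in (0 : ℝ)..s, a τ)) 0 s := fun s => by
    have h := (hf s).mul (ha.integral_hasStrictDerivAt 0 s).hasDerivAt.neg.exp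
    exact h.congr_deriv (by simp; ring)
  have h := is_const_of_deriv_eq_zero (fun s => (hg s).differentiableAt) (fun s => (hg s).deriv) t 0
  simp only [intervalIntegral.integral_same, neg_zero, Real.exp_zero, mul_one] at h
  rw [← h, mul_assoc, ← Real.exp_add]
  simp

section Jacobian

variable {d : ℕ} {v : ℝ → (Fin d → ℝ) → (Fin d → ℝ)} {K : NNReal}
  {X : ℝ → (Fin d → ℝ) → (Fin d → ℝ)}

theorem continuous_dvg_of_uncurry (hvc : ContDiff ℝ 1 (Function.uncurry v)) :
    Continuous fun p : ℝ × (Fin d → ℝ) => dvg (v p.1) p.2 := by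
  have h := continuous_fderiv_of_uncurry hvc
  unfold dvg
  fun_prop

theorem abs_dvg_le {F : (Fin d → ℝ) → (Fin d → ℝ)} (hF : LipschitzWith K F) (x : Fin d → ℝ) :
    |dvg F x| ≤ d * K := by
  refine (Finset.abs_sum_le_sum_abs _ _).trans ?_
  have h : ∀ i ∈ Finset.univ, |fderiv ℝ F x (Pi.single i 1) i| ≤ (K : ℝ) := fun i _ => by
    have h1 := (norm_le_pi_norm (fderiv ℝ F x (Pi.single i 1)) i).trans
      ((fderiv ℝ F x).le_of_opNorm_le (norm_fderiv_le_of_lipschitz ℝ hF) (Pi.single i 1))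
    have h2 : ‖(Pi.single i 1 : Fin d → ℝ)‖ = 1 := by
      rw [Pi.norm_single, norm_one]
    simpa [h2] using h1
  simpa using Finset.sum_le_sum h

theorem trace_toMatrix'_fderiv (F : (Fin d → ℝ) → (Fin d → ℝ)) (x : Fin d → ℝ) :
    (LinearMap.toMatrix' (fderiv ℝ F x : (Fin d → ℝ) →ₗ[ℝ] (Fin d → ℝ))).trace = dvg F x := by
  simp [Matrix.trace, dvg, LinearMap.toMatrix'_apply]

theorem det_fderiv_flow (hvc : ContDiff ℝ 1 (Function.uncurry v))
    (hv : ∀ t, LipschitzWith K (v t)) (hX0 : ∀ x, X 0 x = x)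
    (hX : ∀ t x, HasDerivAt (fun τ => X τ x) (v t (X t x)) t) {x : Fin d → ℝ}
    (hx : ∀ᵐ τ : ℝ, DifferentiableAt ℝ (X τ) x) {t : ℝ} (ht : DifferentiableAt ℝ (X t) x) :
    (fderiv ℝ (X t) x).det = Real.exp (∫ τ in (0 : ℝ)..t, dvg (v τ) (X τ x)) := by
  have hXc := continuous_flow hv hX0 hX
  have hcurve : Continuous fun τ => (τ, X τ x) :=
    continuous_id.prodMk (hXc.comp (continuous_id.prodMk continuous_const))
  let B : ℝ → (Fin d → ℝ) →L[ℝ] (Fin d → ℝ) := fun τ => fderiv ℝ (v τ) (X τ x)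
  have hB : Continuous B := (continuous_fderiv_of_uncurry hvc).comp hcurve
  let w : Fin d → ℝ → (Fin d → ℝ) := fun j s =>
    Pi.single j 1 + ∫ τ in (0 : ℝ)..s, B τ (fderiv ℝ (X τ) x (Pi.single j 1))
  have hline := fun j : Fin d => hasDerivAt_flow_line hvc hv hX0 hX hx (Pi.single j (1 : ℝ))
  have hw : ∀ j s, DifferentiableAt ℝ (X s) x → fderiv ℝ (X s) x (Pi.single j 1) = w j s :=
    fun j s hs => by
      have hl : HasDerivAt (fun h : ℝ => x + h • (Pi.single j 1 : Fin d → ℝ)) (Pi.single j 1) 0 := by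
        simpa using ((hasDerivAt_id (0 : ℝ)).smul_const (Pi.single j (1 : ℝ))).const_add x
      have hs' : HasFDerivAt (X s) (fderiv ℝ (X s) x) (x + (0 : ℝ) • Pi.single j 1) := by
        simpa using hs.hasFDerivAt
      exact (hs'.comp_hasDerivAt (0 : ℝ) hl).unique (hline j s).2
  have hwc : ∀ j, Continuous (w j) := fun j => by
    refine continuous_const.add (intervalIntegral.continuous_primitive (fun a b => ?_) 0)
    exact (hline j a).1.symm.trans (hline j b).1
  have hwint : ∀ j s, w j s = Pi.single j 1 + ∫ τ in (0 : ℝ)..s, B τ (w j τ) := fun j s => by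
    refine congrArg ((Pi.single j 1 : Fin d → ℝ) + ·) (intervalIntegral.integral_congr_ae ?_)
    filter_upwards [hx] with τ hτ _
    rw [hw j τ hτ]
  have hwd : ∀ j s, HasDerivAt (w j) (B s (w j s)) s := fun j s => by
    have h := ((hB.clm_apply (hwc j)).integral_hasStrictDerivAt 0 s).hasDerivAt.const_add
      (Pi.single j (1 : ℝ))
    rwa [← funext (hwint j)] at h
  let N : ℝ → Matrix (Fin d) (Fin d) ℝ := fun s => Matrix.of fun i j => w j s i
  let A : ℝ → Matrix (Fin d) (Fin d) ℝ := fun s =>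
    LinearMap.toMatrix' (B s : (Fin d → ℝ) →ₗ[ℝ] (Fin d → ℝ))
  have hN : ∀ s, HasDerivAt (fun s => (N s).det) (dvg (v s) (X s x) * (N s).det) s := fun s => by
    have h := Matrix.hasDerivAt_det_of_linear_ode (N := N) (A := A s) (t := s) fun i j => by
      refine (hasDerivAt_pi.1 (hwd j s) i).congr_deriv ?_
      have h1 := congrFun (LinearMap.toMatrix'_mulVec (B s : (Fin d → ℝ) →ₗ[ℝ] _) (w j s)) i
      exact h1.symm
    rwa [trace_toMatrix'_fderiv] at h
  have hdet := eq_mul_exp_integral_of_hasDerivAt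
    ((continuous_dvg_of_uncurry hvc).comp hcurve) hN t
  have hN0 : N 0 = 1 := by
    ext i j
    simp [N, w, Matrix.one_apply, Pi.single_apply]
  have hNt : LinearMap.toMatrix' (fderiv ℝ (X t) x : (Fin d → ℝ) →ₗ[ℝ] (Fin d → ℝ)) = N t := by
    ext i j
    have h1 := congrFun (hw j t ht) i
    rw [LinearMap.toMatrix'_apply]
    exact h1
  rw [ContinuousLinearMap.det, ← LinearMap.det_toMatrix', hNt, hdet, hN0, Matrix.det_one, one_mul]
  rfl

theorem ae_det_fderiv_flow (hvc : ContDiff ℝ 1 (Function.uncurry v))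
    (hv : ∀ t, LipschitzWith K (v t)) (hX0 : ∀ x, X 0 x = x)
    (hX : ∀ t x, HasDerivAt (fun τ => X τ x) (v t (X t x)) t) (t : ℝ) :
    ∀ᵐ x, DifferentiableAt ℝ (X t) x ∧
      (fderiv ℝ (X t) x).det = Real.exp (∫ τ in (0 : ℝ)..t, dvg (v τ) (X τ x)) := by
  have hd : ∀ τ, ∀ᵐ x, DifferentiableAt ℝ (X τ) x := fun τ =>
    (lipschitzWith_flow hv hX0 hX τ).ae_differentiableAt
  have hae : ∀ᵐ x : Fin d → ℝ, ∀ᵐ τ : ℝ, DifferentiableAt ℝ (X τ) x :=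
    Measure.ae_ae_comm (measurableSet_of_differentiableAt_with_param ℝ
      (continuous_flow hv hX0 hX)) |>.1 (.of_forall hd)
  filter_upwards [hae, hd t] with x hx hxt
  exact ⟨hxt, det_fderiv_flow hvc hv hX0 hX hx hxt⟩

end Jacobian

/-- If `f` is injective, a.e. differentiable, and transports the density `p` to the density `q`,
then the densities satisfy the change of variables formula almost everywhere. -/
theorem ae_abs_det_fderiv_mul_eq {d : ℕ} {f : (Fin d → ℝ) → (Fin d → ℝ)}
    (hf : Function.Injective f) (hfd : ∀ᵐ x, DifferentiableAt ℝ f x) {p q : (Fin d → ℝ) → ℝ}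
    (hp : Integrable p) (hq : Integrable q)
    (hpush : ∀ φ : (Fin d → ℝ) → ℝ, Integrable (fun y => φ y * q y) →
      (∫ y, φ y * q y) = ∫ x, φ (f x) * p x) :
    ∀ᵐ x, |(fderiv ℝ f x).det| * q (f x) = p x := by
  let S : Set (Fin d → ℝ) := {x | DifferentiableAt ℝ f x}
  have hS : MeasurableSet S := measurableSet_of_differentiableAt ℝ f
  have hder : ∀ B ⊆ S, ∀ x ∈ B, HasFDerivWithinAt f (fderiv ℝ f x) B x := fun B hB x hx =>
    (hB hx : DifferentiableAt ℝ f x).hasFDerivAt.hasFDerivWithinAt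
  have hres : (volume : Measure (Fin d → ℝ)).restrict S = volume :=
    Measure.restrict_eq_self_of_ae_mem hfd
  have hset : ∀ B, MeasurableSet B → B ⊆ S →
      ∫ x in B, |(fderiv ℝ f x).det| * q (f x) = ∫ x in B, p x := fun B hB hBS => by
    have hfB : MeasurableSet (f '' B) :=
      measurable_image_of_fderivWithin hB (hder B hBS) hf.injOn
    have h1 := integral_image_eq_integral_abs_det_fderiv_smul volume hB (hder B hBS) hf.injOn q
    have h2 : (fun y => (f '' B).indicator 1 y * q y) = (f '' B).indicator q := by
      ext y; by_cases hy : y ∈ f '' B <;> simp [hy]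
    have h3 : (fun x => (f '' B).indicator 1 (f x) * p x) = B.indicator p := by
      ext x; by_cases hx : x ∈ B <;> simp [hf.mem_set_image, hx]
    have h4 := hpush ((f '' B).indicator 1) (by rw [h2]; exact hq.indicator hfB)
    rw [h2, h3, integral_indicator hfB, integral_indicator hB] at h4
    simp only [smul_eq_mul] at h1
    rw [← h1, h4]
  have hint : Integrable fun x => |(fderiv ℝ f x).det| * q (f x) := by
    have h := (integrableOn_image_iff_integrableOn_abs_det_fderiv_smul volume hS
      (hder S subset_rfl) hf.injOn q).1 hq.integrableOn
    simpa only [IntegrableOn, hres, smul_eq_mul] using h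
  refine Integrable.ae_eq_of_forall_setIntegral_eq _ _ hint hp fun B hB _ => ?_
  rw [← hres, Measure.restrict_restrict hB]
  exact hset _ (hB.inter hS) Set.inter_subset_right

theorem stmt_10 (d : ℕ) (hd : 1 ≤ d)
    (v : ℝ → (Fin d → ℝ) → (Fin d → ℝ))
    (ρ : ℝ → (Fin d → ℝ) → ℝ)
    (X : ℝ → (Fin d → ℝ) → (Fin d → ℝ))
    -- `v` is C² in `t` and `x` jointly and globally Lipschitz in `x`
    (hv : ContDiff ℝ 2 (Function.uncurry v))
    (hvlip : ∃ K : NNReal, ∀ t, LipschitzWith K (v t))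
    -- `ρ` is an everywhere-positive probability density, C¹ in `t`, C³ in `x`
    (hρpos : ∀ t x, 0 < ρ t x)
    (hρprob : ∀ t, (∫ x, ρ t x) = 1)
    (hρt : ∀ x, ContDiff ℝ 1 (fun t => ρ t x))
    (hρx : ∀ t, ContDiff ℝ 3 (ρ t))
    -- transport equation
    (hTE : ∀ t x, deriv (fun τ => ρ τ x) t = - dvg (fun y => ρ t y • v t y) x)
    -- the flow of `v`
    (hX0 : ∀ x, X 0 x = x)
    (hXflow : ∀ t x, HasDerivAt (fun τ => X τ x) (v t (X t x)) t)
    -- the differential entropy is finite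
    (hHfin : ∀ t, Integrable (fun x => Real.log (ρ t x) * ρ t x))
    -- differentiation under the integral sign is valid
    (hDUI : ∀ t, HasDerivAt (fun τ => ∫ x, Real.log (ρ τ x) * ρ τ x)
      (∫ x, deriv (fun τ => Real.log (ρ τ x) * ρ τ x) t) t)
    -- the pushforward identity holds for the integrands involved
    (hpush : ∀ (t : ℝ) (φ : (Fin d → ℝ) → ℝ), Integrable (fun y => φ y * ρ t y) →
      (∫ y, φ y * ρ t y) = ∫ x, φ (X t x) * ρ 0 x)
    (hdvgint : ∀ t, Integrable (fun x => dvg (v t) (X t x) * ρ 0 x)) :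
    ∀ t : ℝ, 0 ≤ t →
      (-∫ x, Real.log (ρ t x) * ρ t x)
        = (-∫ x, Real.log (ρ 0 x) * ρ 0 x)
          + ∫ τ in (0:ℝ)..t, ∫ x, dvg (v τ) (X τ x) * ρ 0 x := by
  intro t _
  obtain ⟨K, hK⟩ := hvlip
  have hvc : ContDiff ℝ 1 (Function.uncurry v) := hv.of_le (by norm_num)
  have hρint : ∀ t, Integrable (ρ t) := fun t =>
    not_imp_comm.1 integral_undef (by rw [hρprob]; exact one_ne_zero)
  have hXc := continuous_flow hK hX0 hXflow
  have hdc : Continuous fun p : ℝ × (Fin d → ℝ) => dvg (v p.1) (X p.1 p.2) :=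
    (continuous_dvg_of_uncurry hvc).comp (continuous_fst.prodMk hXc)
  have hJ := ae_det_fderiv_flow hvc hK hX0 hXflow t
  have hρ := ae_abs_det_fderiv_mul_eq (injective_flow hK hX0 hXflow t) (hJ.mono fun _ h => h.1)
    (hρint 0) (hρint t) (hpush t)
  have hlog : ∀ᵐ x, Real.log (ρ t (X t x)) * ρ 0 x =
      Real.log (ρ 0 x) * ρ 0 x - ∫ τ in (0 : ℝ)..t, dvg (v τ) (X τ x) * ρ 0 x := by
    filter_upwards [hJ, hρ] with x hx1 hx2
    rw [hx1.2, abs_of_pos (Real.exp_pos _)] at hx2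
    rw [intervalIntegral.integral_mul_const]
    nth_rewrite 2 [← hx2]
    rw [Real.log_mul (Real.exp_pos _).ne' (hρpos _ _).ne', Real.log_exp]
    ring
  have : IsFiniteMeasure (volume.restrict (Set.uIoc 0 t)) := ⟨by simp [Set.uIoc]⟩
  have hprod : Integrable (Function.uncurry fun τ x => dvg (v τ) (X τ x) * ρ 0 x)
      ((volume.restrict (Set.uIoc 0 t)).prod volume) := by
    refine Integrable.bdd_mul (c := d * K) ((hρint 0).comp_snd _) hdc.aestronglyMeasurable
      (.of_forall fun p => abs_dvg_le (hK p.1) _)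
  have hswap := intervalIntegral_integral_swap hprod
  have hdint : Integrable fun x => ∫ τ in (0 : ℝ)..t, dvg (v τ) (X τ x) * ρ 0 x := by
    simp only [intervalIntegral.intervalIntegral_eq_integral_uIoc]
    exact hprod.integral_prod_right.smul (if 0 ≤ t then (1 : ℝ) else -1)
  rw [hpush t (fun y => Real.log (ρ t y)) (hHfin t), integral_congr_ae hlog,
    integral_sub (hHfin 0) hdint, hswap]
  ring
end
end

section
/- Let s : ℝ^d → ℝ^d be C² with bounded first and second derivatives, let σ : ℝ^d → ℝ^{d×d} be continuous, set D(x) = σ(x) σ(x)ᵀ, and let ξ be a standard Gaussian random vector on ℝ^d (law N(0, I_d)). Then for every x ∈ ℝ^d, lim_{α → 0⁺} α^{−1} E[ ⟨s(x + α σ(x) ξ), σ(x) ξ⟩ ] = tr( D(x) ∇s(x) ). -/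
open MeasureTheory Matrix Filter
open scoped Topology

noncomputable section

/-- The standard Gaussian measure on `Fin d → ℝ`, the `d`-fold product of the
standard real Gaussian. -/
def stdGaussian (d : ℕ) : Measure (Fin d → ℝ) :=
  Measure.pi fun _ => ProbabilityTheory.gaussianReal 0 1

lemma abs_dotProduct_le_card_mul_norm {ι : Type*} [Fintype ι] (u v : ι → ℝ) :
    |u ⬝ᵥ v| ≤ Fintype.card ι * (‖u‖ * ‖v‖) := by
  calc |u ⬝ᵥ v| ≤ ∑ i, |u i * v i| := Finset.abs_sum_le_sum_abs _ _
    _ ≤ ∑ _i : ι, ‖u‖ * ‖v‖ := by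
        refine Finset.sum_le_sum fun i _ => ?_
        rw [abs_mul]
        exact mul_le_mul (norm_le_pi_norm u i) (norm_le_pi_norm v i) (abs_nonneg _) (norm_nonneg _)
    _ = Fintype.card ι * (‖u‖ * ‖v‖) := by simp

/-- For a centred square-integrable random vector `w` and a Lipschitz vector field `s`
with derivative `L` at `x`, the correlation of `s (x + α w)` with `w` is `α E⟨L w, w⟩ + o(α)`. -/
lemma tendsto_inv_mul_integral_dotProduct {Ω ι : Type*} [Fintype ι] [MeasurableSpace Ω]
    {μ : Measure Ω} [IsFiniteMeasure μ] {w : Ω → ι → ℝ} (hw : MemLp w 2 μ)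
    (hw0 : ∀ i, ∫ ω, w ω i ∂μ = 0) {s : (ι → ℝ) → (ι → ℝ)} {K : NNReal}
    (hK : LipschitzWith K s) {x : ι → ℝ} {L : (ι → ℝ) →L[ℝ] (ι → ℝ)} (hL : HasFDerivAt s L x) :
    Tendsto (fun α : ℝ => α⁻¹ * ∫ ω, s (x + α • w ω) ⬝ᵥ w ω ∂μ)
      (𝓝[>] 0) (𝓝 (∫ ω, L (w ω) ⬝ᵥ w ω ∂μ)) := by
  have hwi (i : ι) : Integrable (fun ω => w ω i) μ :=
    (hw.integrable one_le_two).eval i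
  have hsq : Integrable (fun ω => ‖w ω‖ ^ 2) μ := hw.integrable_norm_pow two_ne_zero
  have hdot : Continuous fun p : (ι → ℝ) × (ι → ℝ) => p.1 ⬝ᵥ p.2 := by
    unfold dotProduct; fun_prop
  have hmeas (α : ℝ) :
      AEStronglyMeasurable (fun ω => (s (x + α • w ω) - s x) ⬝ᵥ w ω) μ := by
    have hc : Continuous fun v : ι → ℝ => (s (x + α • v) - s x) ⬝ᵥ v := by
      have := hK.continuous
      exact hdot.comp (f := fun v : ι → ℝ => (s (x + α • v) - s x, v)) (by fun_prop)
    exact hc.comp_aestronglyMeasurable hw.1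
  have hbound (α : ℝ) (ω : Ω) : ‖(s (x + α • w ω) - s x) ⬝ᵥ w ω‖ ≤
      |α| * (Fintype.card ι * K * ‖w ω‖ ^ 2) := by
    have h := hK.norm_sub_le (x + α • w ω) x
    rw [add_sub_cancel_left, norm_smul, Real.norm_eq_abs] at h
    calc ‖(s (x + α • w ω) - s x) ⬝ᵥ w ω‖
        ≤ Fintype.card ι * (‖s (x + α • w ω) - s x‖ * ‖w ω‖) :=
          abs_dotProduct_le_card_mul_norm _ _
      _ ≤ Fintype.card ι * (K * (|α| * ‖w ω‖) * ‖w ω‖) := by gcongr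
      _ = _ := by ring
  have hint (α : ℝ) : Integrable (fun ω => (s (x + α • w ω) - s x) ⬝ᵥ w ω) μ :=
    ((hsq.const_mul _).const_mul _).mono' (hmeas α) (ae_of_all _ (hbound α))
  have hcint : Integrable (fun ω => s x ⬝ᵥ w ω) μ :=
    integrable_finsetSum _ fun i _ => (hwi i).const_mul _
  have hc0 : ∫ ω, s x ⬝ᵥ w ω ∂μ = 0 := by
    simp only [dotProduct]
    rw [integral_finsetSum _ fun i _ => (hwi i).const_mul _]
    simp [integral_const_mul, hw0]
  have hcenter (α : ℝ) : α⁻¹ * ∫ ω, s (x + α • w ω) ⬝ᵥ w ω ∂μ =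
      ∫ ω, α⁻¹ * ((s (x + α • w ω) - s x) ⬝ᵥ w ω) ∂μ := by
    rw [integral_const_mul, ← add_zero (∫ ω, (s (x + α • w ω) - s x) ⬝ᵥ w ω ∂μ), ← hc0,
      ← integral_add (hint α) hcint]
    simp [sub_dotProduct]
  simp_rw [hcenter]
  refine tendsto_integral_filter_of_dominated_convergence
    (fun ω => Fintype.card ι * K * ‖w ω‖ ^ 2)
    (Eventually.of_forall fun α => (hmeas α).const_mul _) ?_ (hsq.const_mul _)
    (ae_of_all _ fun ω => ?_)
  · filter_upwards [self_mem_nhdsWithin] with α hα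
    refine ae_of_all _ fun ω => ?_
    have hα : 0 < α := hα
    rw [norm_mul, norm_inv, Real.norm_eq_abs, inv_mul_le_iff₀ (abs_pos.2 hα.ne')]
    exact hbound α ω
  · have h := ((hL.hasLineDerivAt (w ω)).tendsto_slope_zero_right)
    have h2 := (hdot.tendsto (L (w ω), w ω)).comp (h.prodMk_nhds tendsto_const_nhds)
    refine h2.congr fun α => ?_
    simp [smul_dotProduct]

lemma memLp_eval_stdGaussian {d : ℕ} (i : Fin d) :
    MemLp (fun ξ : Fin d → ℝ => ξ i) 2 (stdGaussian d) :=
  (ProbabilityTheory.memLp_id_gaussianReal 2).comp_measurePreserving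
    (measurePreserving_eval (fun _ : Fin d => ProbabilityTheory.gaussianReal 0 1) i)

instance {d : ℕ} : IsProbabilityMeasure (stdGaussian d) := by
  unfold stdGaussian; infer_instance

lemma integral_comp_eval_stdGaussian {d : ℕ} (i : Fin d) {f : ℝ → ℝ} (hf : Continuous f) :
    ∫ ξ, f (ξ i) ∂(stdGaussian d) = ∫ y, f y ∂(ProbabilityTheory.gaussianReal 0 1) :=
  integral_comp_eval (μ := fun _ : Fin d => ProbabilityTheory.gaussianReal 0 1) (i := i)
    hf.aestronglyMeasurable

lemma integral_eval_stdGaussian {d : ℕ} (i : Fin d) :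
    ∫ ξ, ξ i ∂(stdGaussian d) = 0 :=
  (integral_comp_eval_stdGaussian i continuous_id).trans
    ProbabilityTheory.integral_id_gaussianReal

lemma integral_eval_mul_eval_stdGaussian {d : ℕ} (i j : Fin d) :
    ∫ ξ, ξ i * ξ j ∂(stdGaussian d) = if i = j then 1 else 0 := by
  split_ifs with h
  · subst h
    rw [integral_comp_eval_stdGaussian i (f := fun y : ℝ => y * y) (by fun_prop)]
    have h := ProbabilityTheory.variance_fun_id_gaussianReal (μ := 0) (v := 1)
    rw [ProbabilityTheory.variance_eq_integral (by fun_prop)] at h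
    simpa [ProbabilityTheory.integral_id_gaussianReal, ← pow_two] using h
  · have hind : ProbabilityTheory.iIndepFun (fun (i : Fin d) (ξ : Fin d → ℝ) => ξ i)
        (stdGaussian d) :=
      ProbabilityTheory.iIndepFun_pi (X := fun _ y => y) fun _ => by fun_prop
    rw [(hind.indepFun h).integral_fun_mul_eq_mul_integral
      (memLp_eval_stdGaussian i).1 (memLp_eval_stdGaussian j).1,
      integral_eval_stdGaussian, zero_mul]

lemma memLp_mulVec_stdGaussian {d : ℕ} (A : Matrix (Fin d) (Fin d) ℝ) :
    MemLp (fun ξ => A.mulVec ξ) 2 (stdGaussian d) :=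
  memLp_pi_iff.2 fun i => memLp_finsetSum Finset.univ fun j _ =>
    (memLp_eval_stdGaussian j).const_mul (A i j)

lemma integral_mulVec_stdGaussian {d : ℕ} (A : Matrix (Fin d) (Fin d) ℝ) (i : Fin d) :
    ∫ ξ, A.mulVec ξ i ∂(stdGaussian d) = 0 := by
  simp only [mulVec, dotProduct]
  rw [integral_finsetSum _ fun j _ =>
    ((memLp_eval_stdGaussian j).integrable one_le_two).const_mul _]
  simp [integral_const_mul, integral_eval_stdGaussian]

/-- The second-moment identity `E⟨A ξ, B ξ⟩ = tr (Bᵀ A)` for a standard Gaussian vector `ξ`. -/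
lemma integral_mulVec_dotProduct_mulVec_stdGaussian {d : ℕ} (A B : Matrix (Fin d) (Fin d) ℝ) :
    ∫ ξ, A.mulVec ξ ⬝ᵥ B.mulVec ξ ∂(stdGaussian d) = (Bᵀ * A).trace := by
  have hint (i j k : Fin d) : Integrable (fun ξ : Fin d → ℝ => A i j * B i k * (ξ j * ξ k))
      (stdGaussian d) :=
    ((memLp_eval_stdGaussian j).integrable_mul (memLp_eval_stdGaussian k)).const_mul _
  have hexp (ξ : Fin d → ℝ) : A.mulVec ξ ⬝ᵥ B.mulVec ξ =
      ∑ i, ∑ j, ∑ k, A i j * B i k * (ξ j * ξ k) := by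
    simp only [mulVec, dotProduct, Finset.sum_mul_sum]
    exact Finset.sum_congr rfl fun i _ => Finset.sum_congr rfl fun j _ =>
      Finset.sum_congr rfl fun k _ => by ring
  simp_rw [hexp]
  rw [integral_finsetSum _ fun i _ => integrable_finsetSum _ fun j _ =>
    integrable_finsetSum _ fun k _ => hint i j k]
  simp_rw [integral_finsetSum _ fun j _ => integrable_finsetSum _ fun k _ => hint _ j k,
    integral_finsetSum _ fun k _ => hint _ _ k, integral_const_mul,
    integral_eval_mul_eval_stdGaussian]
  simp only [mul_ite, mul_one, mul_zero, Finset.sum_ite_eq, Finset.mem_univ, if_true, trace,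
    diag_apply, mul_apply, transpose_apply]
  rw [Finset.sum_comm]
  simp_rw [mul_comm]

lemma fderiv_apply_eq_jac_mulVec {d : ℕ} (F : (Fin d → ℝ) → (Fin d → ℝ)) (x v : Fin d → ℝ) :
    fderiv ℝ F x v = (jac F x).mulVec v := by
  have h : jac F x = LinearMap.toMatrix' (fderiv ℝ F x : (Fin d → ℝ) →ₗ[ℝ] (Fin d → ℝ)) := by
    ext i j
    simp [jac, LinearMap.toMatrix'_apply]
  rw [h, LinearMap.toMatrix'_mulVec]
  rfl

theorem stmt_13 (d : ℕ) (hd : 1 ≤ d)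
    (s : (Fin d → ℝ) → (Fin d → ℝ))
    (σ : (Fin d → ℝ) → Matrix (Fin d) (Fin d) ℝ)
    (D : (Fin d → ℝ) → Matrix (Fin d) (Fin d) ℝ)
    -- `s` is C² with bounded first and second derivatives
    (hs : ContDiff ℝ 2 s)
    (hs1 : ∃ M, ∀ x, ‖fderiv ℝ s x‖ ≤ M)
    (hs2 : ∃ M, ∀ x, ‖fderiv ℝ (fderiv ℝ s) x‖ ≤ M)
    -- `σ` is continuous and `D = σ σᵀ`
    (hσ : ∀ i j, Continuous (fun x => σ x i j))
    (hσD : ∀ x, D x = σ x * (σ x)ᵀ)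
    (x : Fin d → ℝ) :
    Tendsto (fun α : ℝ =>
        α⁻¹ * ∫ ξ, (s (x + α • (σ x).mulVec ξ) ⬝ᵥ (σ x).mulVec ξ) ∂(stdGaussian d))
      (𝓝[>] 0) (𝓝 ((D x * jac s x).trace)) := by
  obtain ⟨M, hM⟩ := hs1
  have hdiff : Differentiable ℝ s := hs.differentiable two_ne_zero
  have hLip : LipschitzWith M.toNNReal s :=
    lipschitzWith_of_nnnorm_fderiv_le hdiff fun y => NNReal.coe_le_coe.1 <|
      (hM y).trans (Real.le_coe_toNNReal M)
  have h := tendsto_inv_mul_integral_dotProduct (memLp_mulVec_stdGaussian (σ x))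
    (integral_mulVec_stdGaussian (σ x)) hLip (hdiff x).hasFDerivAt
  have htr : (D x * jac s x).trace = ((σ x)ᵀ * (jac s x * σ x)).trace := by
    rw [hσD, Matrix.mul_assoc, trace_mul_comm, Matrix.mul_assoc]
  rw [htr, ← integral_mulVec_dotProduct_mulVec_stdGaussian]
  simpa only [fderiv_apply_eq_jac_mulVec, mulVec_mulVec] using h
end
end

section
/- Fix d ≥ 1. Let Γ_t, D_t ∈ ℝ^{d×d} and b_t ∈ ℝ^d depend continuously on t, let m : ℝ_{≥0} → ℝ^d and C : ℝ_{≥0} → ℝ^{d×d} be C¹ with C_t invertible for all t, satisfying dm_t/dt = −Γ_t (m_t − b_t) and dC_t/dt = −Γ_t C_t − C_t Γ_tᵀ + 2 D_t. Let X : ℝ_{≥0} → ℝ^d be C¹ and satisfy the Ornstein–Uhlenbeck probability flow equation dX_t/dt = (D_t C_t^{−1} − Γ_t) X_t + Γ_t b_t − D_t C_t^{−1} m_t. Then the curve G_t := −C_t^{−1}(X_t − m_t) satisfies dG_t/dt = (Γ_tᵀ − C_t^{−1} D_t) G_t. -/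
open Matrix
noncomputable section

attribute [local instance] Matrix.normedAddCommGroup Matrix.normedSpace

theorem Matrix.continuousAt_nonsing_inv {n : Type*} [Fintype n] [DecidableEq n]
    {A : Matrix n n ℝ} (hA : IsUnit A.det) :
    ContinuousAt (fun B : Matrix n n ℝ => B⁻¹) A := by
  simp only [Matrix.inv_def, Ring.inverse_eq_inv']
  exact (continuous_id.matrix_det.continuousAt.inv₀ hA.ne_zero).smul
    continuous_id.matrix_adjugate.continuousAt

/-- The derivative of the solution `(C τ)⁻¹ *ᵥ y τ` of a time-dependent linear system. -/
theorem HasDerivAt.nonsing_inv_mulVec {n : Type*} [Fintype n] [DecidableEq n]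
    {C : ℝ → Matrix n n ℝ} {y : ℝ → n → ℝ} {C' : Matrix n n ℝ} {y' : n → ℝ} {t : ℝ}
    (hinv : ∀ s, IsUnit (C s).det) (hC : HasDerivAt C C' t) (hy : HasDerivAt y y' t) :
    HasDerivAt (fun τ => (C τ)⁻¹ *ᵥ y τ) ((C t)⁻¹ *ᵥ (y' - C' *ᵥ ((C t)⁻¹ *ᵥ y t))) t := by
  have hI := ((Matrix.continuousAt_nonsing_inv (hinv t)).comp hC.continuousAt).tendsto.mono_left
    (nhdsWithin_le_nhds (s := {t}ᶜ))
  have hcont : Continuous fun p : Matrix n n ℝ × (n → ℝ) => p.1 *ᵥ p.2 :=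
    continuous_fst.matrix_mulVec continuous_snd
  replace hC := hasDerivAt_iff_tendsto_slope.mp hC
  rw [hasDerivAt_iff_tendsto_slope] at hy ⊢
  have hCw := (hcont.tendsto (C', (C t)⁻¹ *ᵥ y t)).comp (hC.prodMk_nhds tendsto_const_nhds)
  refine ((hcont.tendsto _).comp (hI.prodMk_nhds (hy.sub hCw))).congr fun s => ?_
  have h : (C s)⁻¹ *ᵥ (C s *ᵥ ((C t)⁻¹ *ᵥ y t)) = (C t)⁻¹ *ᵥ y t := by
    rw [mulVec_mulVec, nonsing_inv_mul _ (hinv s), one_mulVec]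
  have h' : C t *ᵥ ((C t)⁻¹ *ᵥ y t) = y t := by
    rw [mulVec_mulVec, mul_nonsing_inv _ (hinv t), one_mulVec]
  simp only [Function.comp_apply, slope_def_module, smul_mulVec, ← smul_sub, mulVec_smul,
    sub_mulVec, h', mulVec_sub, h]
  congr 1
  abel

theorem stmt_18 (d : ℕ) (hd : 1 ≤ d)
    (Γ D : ℝ → Matrix (Fin d) (Fin d) ℝ) (b : ℝ → Fin d → ℝ)
    -- continuous dependence on time
    (hΓ : Continuous Γ) (hD : Continuous D) (hb : Continuous b)
    (m : ℝ → Fin d → ℝ) (C : ℝ → Matrix (Fin d) (Fin d) ℝ)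
    -- `C t` invertible
    (hCinv : ∀ t, IsUnit (C t).det)
    -- mean and covariance dynamics
    (hm : ∀ t, HasDerivAt m (-(Γ t).mulVec (m t - b t)) t)
    (hC : ∀ t, HasDerivAt C (-(Γ t * C t) - C t * (Γ t)ᵀ + (2 : ℝ) • D t) t)
    (X : ℝ → Fin d → ℝ)
    -- the Ornstein-Uhlenbeck probability flow
    (hX : ∀ t, HasDerivAt X
      ((D t * (C t)⁻¹ - Γ t).mulVec (X t) + (Γ t).mulVec (b t)
        - (D t * (C t)⁻¹).mulVec (m t)) t) :
    ∀ t : ℝ, HasDerivAt (fun τ => -((C τ)⁻¹).mulVec (X τ - m τ))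
      (((Γ t)ᵀ - (C t)⁻¹ * D t).mulVec (-((C t)⁻¹).mulVec (X t - m t))) t := by
  intro t
  refine (HasDerivAt.nonsing_inv_mulVec hCinv (hC t) ((hX t).sub (hm t))).neg.congr_deriv ?_
  simp only [Pi.sub_apply]
  generalize hw : (C t)⁻¹ *ᵥ (X t - m t) = w
  have hCw : X t - m t = C t *ᵥ w := by
    rw [← hw, mulVec_mulVec, mul_nonsing_inv _ (hCinv t), one_mulVec]
  have hy' : (D t * (C t)⁻¹ - Γ t) *ᵥ X t + Γ t *ᵥ b t - (D t * (C t)⁻¹) *ᵥ m t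
      - -(Γ t *ᵥ (m t - b t)) = D t *ᵥ w - Γ t *ᵥ (C t *ᵥ w) := by
    rw [← hCw, ← hw]
    simp only [sub_mulVec, mulVec_sub, mulVec_mulVec]
    abel
  have hinv : (C t)⁻¹ *ᵥ (C t *ᵥ ((Γ t)ᵀ *ᵥ w)) = (Γ t)ᵀ *ᵥ w := by
    rw [mulVec_mulVec, nonsing_inv_mul _ (hCinv t), one_mulVec]
  have hd' : D t *ᵥ w - Γ t *ᵥ (C t *ᵥ w)
      - (-(Γ t * C t) - C t * (Γ t)ᵀ + (2 : ℝ) • D t) *ᵥ w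
      = C t *ᵥ ((Γ t)ᵀ *ᵥ w) - D t *ᵥ w := by
    simp only [add_mulVec, sub_mulVec, neg_mulVec, mulVec_mulVec, two_smul]
    abel
  rw [hy', hd', mulVec_sub, hinv, mulVec_neg, sub_mulVec, mulVec_mulVec]
end
end
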